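/- arXiv:2501.09582 — 2 statements merged into one kernel-verified Lean document; each statement's English description precedes it below -/
import Mathlib

section
/- Let m ≥ 1 be an integer and set K_m = ⌈(20/19)(log_{1.999}(m+2) + 24) + 4⌉. If k ≥ K_m is an integer and q ∈ (1,2) satisfies |q − q_k| < q_k^{−(m+2)k−3}, then q ∈ B_{m+2}, and moreover the Hausdorff dimension of U_q^{(m+2)} satisfies dim_H(U_q^{(m+2)}) ≥ 1 − 1024·(m+2)^{20/19}·q^{4−k} > 0. -/
open Set

/-- Projection map: the value of the (0-indexed) digit sequence `a` in base `q`,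
`π_q(a) = Σ_{j=0}^∞ a_j q^{-(j+1)}`. -/
noncomputable def piQ (q : ℝ) (a : ℕ → ℝ) : ℝ := ∑' j : ℕ, a j / q ^ (j + 1)

/-- `a` is a sequence of digits in `{0,1}`. -/
def IsDigitSeq (a : ℕ → ℝ) : Prop := ∀ j, a j = 0 ∨ a j = 1

/-- `a` is a sequence of digits in `{-1,0,1}`. -/
def IsExtDigitSeq (a : ℕ → ℝ) : Prop := ∀ j, a j = -1 ∨ a j = 0 ∨ a j = 1

/-- The set of base-`q` expansions of `x`. -/
def SigmaSet (q x : ℝ) : Set (ℕ → ℝ) := {a | IsDigitSeq a ∧ piQ q a = x}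

/-- The interval `I_q = [0, 1/(q-1)]`. -/
def Iq (q : ℝ) : Set ℝ := Set.Icc 0 (1 / (q - 1))

/-- The switch region `J_q = [1/q, 1/(q(q-1))]`. -/
def Jq (q : ℝ) : Set ℝ := Set.Icc (1 / q) (1 / (q * (q - 1)))

/-- The set of points of `I_q` having exactly `m` base-`q` expansions. -/
def UqM (q : ℝ) (m : ℕ∞) : Set ℝ := {x | x ∈ Iq q ∧ (SigmaSet q x).encard = m}

/-- The set of points of `I_q` having a unique base-`q` expansion. -/
def Uq (q : ℝ) : Set ℝ := UqM q 1

/-- `B_m`: the set of bases `q ∈ (1,2)` for which some point has exactly `m` expansions. -/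
def Bset (m : ℕ∞) : Set ℝ := {q | q ∈ Set.Ioo (1 : ℝ) 2 ∧ (UqM q m).Nonempty}

/-- `x` is the `k`-Bonacci number: the root in `(1,2)` of `x^k = x^{k-1} + ⋯ + x + 1`. -/
def IsBonacci (k : ℕ) (x : ℝ) : Prop :=
  x ∈ Set.Ioo (1 : ℝ) 2 ∧ x ^ k = ∑ i ∈ Finset.range k, x ^ i

/-- `a` contains no occurrence of the word `01^k` as a consecutive block. -/
def AvoidsWord01 (k : ℕ) (a : ℕ → ℝ) : Prop :=
  ∀ i, ¬(a i = 0 ∧ ∀ j, 1 ≤ j → j ≤ k → a (i + j) = 1)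

/-- `a` contains no occurrence of the word `10^k` as a consecutive block. -/
def AvoidsWord10 (k : ℕ) (a : ℕ → ℝ) : Prop :=
  ∀ i, ¬(a i = 1 ∧ ∀ j, 1 ≤ j → j ≤ k → a (i + j) = 0)

/-- `S_k`: the set of `{0,1}`-sequences avoiding the words `01^k` and `10^k`. -/
def Sset (k : ℕ) : Set (ℕ → ℝ) := {a | IsDigitSeq a ∧ AvoidsWord01 k a ∧ AvoidsWord10 k a}

/-- `g_{q,k} = f_1^{-(k-1)} ∘ f_0^{-1}`, where `f_0^{-1}(y) = y/q` and `f_1^{-1}(y) = (y+1)/q`. -/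
noncomputable def gMap (q : ℝ) (k : ℕ) (x : ℝ) : ℝ := (fun y => (y + 1) / q)^[k - 1] (x / q)

/-- The maps `f_0(x) = qx` (for `b = false`) and `f_1(x) = qx - 1` (for `b = true`). -/
noncomputable def fDigit (q : ℝ) (b : Bool) (x : ℝ) : ℝ := if b then q * x - 1 else q * x

/-- `(a, b)` is a bounded gap of `C`: a bounded connected component of `ℝ \ C`. -/
def IsGap (C : Set ℝ) (a b : ℝ) : Prop :=
  a < b ∧ a ∈ C ∧ b ∈ C ∧ Set.Ioo a b ∩ C = ∅

/-- The left endpoint of the bridge of `C` lying immediately to the left of the gap `(a, b)`: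
the right endpoint of the nearest gap to the left having diameter at least `b - a`
(or `min C` if there is no such gap). -/
noncomputable def leftBridgeStart (C : Set ℝ) (a b : ℝ) : ℝ :=
  sSup ({sInf C} ∪ {d | ∃ c, IsGap C c d ∧ d ≤ a ∧ b - a ≤ d - c})

/-- The right endpoint of the bridge of `C` lying immediately to the right of the gap `(a, b)`. -/
noncomputable def rightBridgeEnd (C : Set ℝ) (a b : ℝ) : ℝ :=
  sInf ({sSup C} ∪ {c | ∃ d, IsGap C c d ∧ b ≤ c ∧ b - a ≤ d - c})

/-- The (Newhouse) thickness of a compact set `C ⊆ ℝ`: the infimum over all bounded gaps `G`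
of the ratio of the length of the bridge on either side of `G` to the length of `G`
(`∞` if `C` has no bounded gap). -/
noncomputable def thickness (C : Set ℝ) : ENNReal :=
  ⨅ p : {p : ℝ × ℝ // IsGap C p.1 p.2},
    ENNReal.ofReal
      (min ((p.1.1 - leftBridgeStart C p.1.1 p.1.2) / (p.1.2 - p.1.1))
        ((rightBridgeEnd C p.1.1 p.1.2 - p.1.2) / (p.1.2 - p.1.1)))

/-- `B` is contained in a gap of `A`, i.e. in a connected component of `ℝ \ A`. -/
def ContainedInGap (B A : Set ℝ) : Prop :=
  ∃ x ∈ Aᶜ, B ⊆ connectedComponentIn Aᶜ x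

/-- Two sets are interleaved if neither is contained in a gap of the other. -/
def Interleaved (A B : Set ℝ) : Prop :=
  ¬ContainedInGap B A ∧ ¬ContainedInGap A B

/-- `A` and `B` are `ε`-strongly interleaved: any compact sets within Hausdorff distance `ε`
of `A` and `B` respectively are interleaved. -/
def StronglyInterleaved (ε : ℝ) (A B : Set ℝ) : Prop :=
  ∀ A' B' : Set ℝ, IsCompact A' → IsCompact B' →
    EMetric.hausdorffEdist A A' ≤ ENNReal.ofReal ε →
    EMetric.hausdorffEdist B B' ≤ ENNReal.ofReal ε → Interleaved A' B'

/-- The sequence `0^{k-3}(01^{k-1})^∞` (0-indexed). -/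
noncomputable def seqG (k : ℕ) : ℕ → ℝ := fun j =>
  if j < k - 3 then 0 else if (j - (k - 3)) % k = 0 then 0 else 1

/-- The sequence `1^{k-3}(10^{k-1})^∞` (0-indexed). -/
noncomputable def seqH (k : ℕ) : ℕ → ℝ := fun j =>
  if j < k - 3 then 1 else if (j - (k - 3)) % k = 0 then 1 else 0

/-- The sequence `(1^{k-1}0)^∞` (0-indexed). -/
noncomputable def seqP (k : ℕ) : ℕ → ℝ := fun j => if j % k = k - 1 then 0 else 1


theorem le_dimH_of_branching {Q ℓ₀ a₀ : ℝ} {b B : ℕ} (hQ : 1 < Q) (hℓ : 0 < ℓ₀) (hb : 2 ≤ b)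
    (hB : (B : ℝ) ≤ Q) (P : ℕ → ℝ → Prop) (h0 : P 0 a₀)
    (hP : ∀ n a, P n a → ∃ c : ℕ → ℕ,
      (∀ i < b, c i < B ∧ P (n + 1) (a + c i * (ℓ₀ / Q ^ (n + 1)))) ∧
        ∀ i j, i < j → j < b → c i < c j)
    {E : Set ℝ} (hE : ∀ x, (∀ n, ∃ a, P n a ∧ x ∈ Icc a (a + ℓ₀ / Q ^ n)) → x ∈ E) :
    ENNReal.ofReal (Real.log b / Real.log Q) ≤ dimH E := by
  have hQ0 : 0 < Q := by linarith
  have hb0 : 0 < b := by omega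
  have hb1 : (1 : ℝ) < b := by exact_mod_cast hb
  have hex : ∀ n a, ∃ c : ℕ → ℕ, P n a →
      (∀ i < b, c i < B ∧ P (n + 1) (a + c i * (ℓ₀ / Q ^ (n + 1)))) ∧
        ∀ i j, i < j → j < b → c i < c j := by
    intro n a
    by_cases h : P n a
    · obtain ⟨c, hc⟩ := hP n a h
      exact ⟨c, fun _ => hc⟩
    · exact ⟨fun _ => 0, fun h' => absurd h' h⟩
  choose c hc using hex
  let α : ℕ → ℕ → ℝ := fun n => Nat.rec (fun _ => a₀)
    (fun n f v => f (v / b) + c n (f (v / b)) (v % b) * (ℓ₀ / Q ^ (n + 1))) n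
  have hα : ∀ n v, α (n + 1) v =
      α n (v / b) + c n (α n (v / b)) (v % b) * (ℓ₀ / Q ^ (n + 1)) := fun _ _ => rfl
  have hPα : ∀ n v, P n (α n v) := by
    intro n
    induction n with
    | zero => exact fun _ => h0
    | succ n ih =>
      intro v
      rw [hα]
      exact ((hc n _ (ih (v / b))).1 _ (Nat.mod_lt _ hb0)).2
  have hlen : ∀ n : ℕ, 0 < ℓ₀ / Q ^ n := fun n => by positivity
  have hBl : ∀ n : ℕ, B * (ℓ₀ / Q ^ (n + 1)) ≤ ℓ₀ / Q ^ n := by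
    intro n
    have : Q * (ℓ₀ / Q ^ (n + 1)) = ℓ₀ / Q ^ n := by field_simp; ring
    rw [← this]
    exact mul_le_mul_of_nonneg_right hB (hlen _).le
  have hnest : ∀ n v, α n (v / b) ≤ α (n + 1) v ∧
      α (n + 1) v + ℓ₀ / Q ^ (n + 1) ≤ α n (v / b) + ℓ₀ / Q ^ n := by
    intro n v
    rw [hα]
    have h1 := ((hc n _ (hPα n (v / b))).1 _ (Nat.mod_lt v hb0)).1
    have h2 : (c n (α n (v / b)) (v % b) : ℝ) + 1 ≤ B := by exact_mod_cast h1
    have h3 := mul_le_mul_of_nonneg_right h2 (hlen (n + 1)).le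
    have := hBl n
    constructor
    · have : (0 : ℝ) ≤ c n (α n (v / b)) (v % b) * (ℓ₀ / Q ^ (n + 1)) := by positivity
      linarith
    · linarith
  have hsep : ∀ n v w, v < w → w < b ^ n → α n v + ℓ₀ / Q ^ n ≤ α n w := by
    intro n
    induction n with
    | zero => intro v w h1 h2; simp at h2; omega
    | succ n ih =>
      intro v w h1 h2
      have hle : v / b ≤ w / b := Nat.div_le_div_right h1.le
      rcases hle.lt_or_eq with h | h
      · have hw : w / b < b ^ n := by
          rw [Nat.div_lt_iff_lt_mul hb0]; rwa [pow_succ] at h2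
        linarith [ih _ _ h hw, (hnest n v).2, (hnest n w).1]
      · rw [hα, hα, h]
        have hm : v % b < w % b := by
          have e1 := Nat.div_add_mod v b
          have e2 := Nat.div_add_mod w b
          rw [h] at e1
          omega
        have h3 := (hc n _ (hPα n (w / b))).2 _ _ hm (Nat.mod_lt _ hb0)
        have h4 : (c n (α n (w / b)) (v % b) : ℝ) + 1 ≤ c n (α n (w / b)) (w % b) := by
          exact_mod_cast h3
        nlinarith [hlen (n + 1)]
  have hx : ∀ u : ℝ, ∃ x, ∀ n, x ∈ Icc (α n ⌊u * b ^ n⌋₊) (α n ⌊u * b ^ n⌋₊ + ℓ₀ / Q ^ n) := by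
    intro u
    have hfl : ∀ n : ℕ, ⌊u * b ^ (n + 1)⌋₊ / b = ⌊u * (b : ℝ) ^ n⌋₊ := by
      intro n
      rw [← Nat.floor_div_natCast]
      congr 1
      field_simp
      ring
    have hmono : Monotone fun n => α n ⌊u * (b : ℝ) ^ n⌋₊ := by
      refine monotone_nat_of_le_succ fun n => ?_
      have := (hnest n ⌊u * (b : ℝ) ^ (n + 1)⌋₊).1
      rwa [hfl] at this
    have hanti : Antitone fun n => α n ⌊u * (b : ℝ) ^ n⌋₊ + ℓ₀ / Q ^ n := by
      refine antitone_nat_of_succ_le fun n => ?_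
      have := (hnest n ⌊u * (b : ℝ) ^ (n + 1)⌋₊).2
      rwa [hfl] at this
    have := hmono.ciSup_mem_iInter_Icc_of_antitone hanti fun n => by
      simpa using (hlen n).le
    exact ⟨_, fun n => mem_iInter.1 this n⟩
  choose x hx using hx
  set s := Real.log b / Real.log Q with hs
  have hspos : 0 < s := div_pos (Real.log_pos hb1) (Real.log_pos hQ)
  have hQs : Q ^ s = b := by
    rw [Real.rpow_def_of_pos hQ0, hs, mul_div_cancel₀ _ (Real.log_pos hQ).ne',
      Real.exp_log (by linarith)]
  have key : ∀ u ∈ Ico (0 : ℝ) 1, ∀ v ∈ Ico (0 : ℝ) 1, u < v →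
      x u < x v ∧ v - u ≤ 3 * b * ℓ₀⁻¹ ^ s * (x v - x u) ^ s := by
    intro u hu v hv huv
    have hd : 0 < v - u := by linarith
    obtain ⟨n, hn1, hn2⟩ := exists_nat_pow_near (x := 3 / (v - u)) (y := (b : ℝ))
      (by rw [le_div_iff₀ hd]; linarith [hu.1, hv.2]) hb1
    rw [le_div_iff₀ hd] at hn1
    rw [div_lt_iff₀ hd] at hn2
    have hbn : (0 : ℝ) < b ^ (n + 1) := by positivity
    have f1 : (⌊u * (b : ℝ) ^ (n + 1)⌋₊ : ℝ) ≤ u * b ^ (n + 1) :=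
      Nat.floor_le (mul_nonneg hu.1 hbn.le)
    have f2 := Nat.lt_floor_add_one (v * (b : ℝ) ^ (n + 1))
    have f3 : ⌊u * (b : ℝ) ^ (n + 1)⌋₊ + 2 ≤ ⌊v * (b : ℝ) ^ (n + 1)⌋₊ := by
      have : (⌊u * (b : ℝ) ^ (n + 1)⌋₊ + 1 : ℝ) < ⌊v * (b : ℝ) ^ (n + 1)⌋₊ := by nlinarith
      exact_mod_cast this
    have f4 : ⌊v * (b : ℝ) ^ (n + 1)⌋₊ < b ^ (n + 1) := by
      rw [Nat.floor_lt (mul_nonneg hv.1 hbn.le)]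
      push_cast
      nlinarith [hv.2]
    have g1 := hsep (n + 1) ⌊u * (b : ℝ) ^ (n + 1)⌋₊ (⌊u * (b : ℝ) ^ (n + 1)⌋₊ + 1)
      (by omega) (by omega)
    have g2 := hsep (n + 1) (⌊u * (b : ℝ) ^ (n + 1)⌋₊ + 1) ⌊v * (b : ℝ) ^ (n + 1)⌋₊
      (by omega) f4
    have g3 : ℓ₀ / Q ^ (n + 1) ≤ x v - x u := by
      linarith [(hx u (n + 1)).2, (hx v (n + 1)).1]
    have hpos := hlen (n + 1)
    refine ⟨by linarith, ?_⟩
    have e1 : (ℓ₀⁻¹ * (ℓ₀ / Q ^ (n + 1))) ^ s = ((b : ℝ) ^ (n + 1))⁻¹ := by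
      rw [show ℓ₀⁻¹ * (ℓ₀ / Q ^ (n + 1)) = (Q ^ (n + 1))⁻¹ by field_simp,
        Real.inv_rpow (by positivity), ← Real.rpow_natCast, ← Real.rpow_mul hQ0.le,
        mul_comm, Real.rpow_mul hQ0.le, hQs, Real.rpow_natCast]
    have e2 : ((b : ℝ) ^ (n + 1))⁻¹ ≤ ℓ₀⁻¹ ^ s * (x v - x u) ^ s := by
      rw [← e1, ← Real.mul_rpow (by positivity) (by linarith)]
      exact Real.rpow_le_rpow (by positivity) (by gcongr) hspos.le
    have e3 : v - u ≤ 3 * b * ((b : ℝ) ^ (n + 1))⁻¹ := by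
      rw [← div_eq_mul_inv, le_div_iff₀ hbn, pow_succ]
      nlinarith
    calc v - u ≤ 3 * b * ((b : ℝ) ^ (n + 1))⁻¹ := e3
      _ ≤ 3 * b * (ℓ₀⁻¹ ^ s * (x v - x u) ^ s) := by gcongr
      _ = _ := by ring
  have hinj : InjOn x (Ico 0 1) := by
    intro u hu v hv huv
    rcases lt_trichotomy u v with h | h | h
    · exact absurd huv (key u hu v hv h).1.ne
    · exact h
    · exact absurd huv (key v hv u hu h).1.ne'
  have habs : ∀ u ∈ Ico (0 : ℝ) 1, ∀ v ∈ Ico (0 : ℝ) 1,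
      |u - v| ≤ 3 * b * ℓ₀⁻¹ ^ s * |x u - x v| ^ s := by
    intro u hu v hv
    rcases lt_trichotomy u v with h | h | h
    · obtain ⟨h1, h2⟩ := key u hu v hv h
      rwa [abs_sub_comm, abs_of_pos (by linarith), abs_sub_comm, abs_of_pos (by linarith)]
    · rw [h, sub_self, abs_zero]
      positivity
    · obtain ⟨h1, h2⟩ := key v hv u hu h
      rwa [abs_of_pos (by linarith), abs_of_pos (by linarith)]
  have hinv : ∀ u ∈ Ico (0 : ℝ) 1, Function.invFunOn x (Ico 0 1) (x u) = u := fun u hu =>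
    hinj.leftInvOn_invFunOn hu
  have hhol : HolderOnWith (3 * b * ℓ₀⁻¹ ^ s).toNNReal s.toNNReal
      (Function.invFunOn x (Ico 0 1)) (x '' Ico 0 1) := by
    rintro _ ⟨u, hu, rfl⟩ _ ⟨v, hv, rfl⟩
    rw [hinv u hu, hinv v hv, edist_dist, edist_dist, Real.dist_eq, Real.dist_eq,
      Real.coe_toNNReal _ hspos.le, ENNReal.ofReal_rpow_of_nonneg (abs_nonneg _) hspos.le]
    change _ ≤ ENNReal.ofReal _ * _
    rw [← ENNReal.ofReal_mul (by positivity)]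
    exact ENNReal.ofReal_le_ofReal (habs u hu v hv)
  have hdim := hhol.dimH_image_le (Real.toNNReal_pos.2 hspos)
  have himg : Function.invFunOn x (Ico 0 1) '' (x '' Ico 0 1) = Ico 0 1 :=
    hinj.leftInvOn_invFunOn.image_image
  rw [himg, Real.dimH_of_nonempty_interior (by simp)] at hdim
  have hsub : x '' Ico 0 1 ⊆ E := by
    rintro _ ⟨u, -, rfl⟩
    exact hE _ fun n => ⟨_, hPα n _, hx u n⟩
  refine le_trans ?_ (dimH_mono hsub)
  rw [ENNReal.le_div_iff_mul_le (by left; simpa using hspos) (by simp), Module.finrank_self,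
    Nat.cast_one, one_mul] at hdim
  exact hdim

theorem card_le_of_clustered {H : Finset ℕ} {B s₀ D : ℕ} (hs₀ : 0 < s₀) (hB : ∀ t ∈ H, t < B)
    (h : ∀ t ∈ H, ∀ t' ∈ H, t < t' → t' - t < s₀ → t' - t ≤ D) :
    H.card ≤ (D + 1) * (B / s₀ + 1) := by
  have hmaps : ∀ t ∈ H, t / s₀ ∈ Finset.range (B / s₀ + 1) := fun t ht =>
    Finset.mem_range.2 (Nat.lt_succ_of_le (Nat.div_le_div_right (hB t ht).le))
  have := Finset.card_le_mul_card_image_of_maps_to hmaps (D + 1) fun b _ => ?_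
  · simpa using this
  · set F := H.filter fun t => t / s₀ = b
    rcases F.eq_empty_or_nonempty with h0 | hne
    · simp [h0]
    have hsub : F ⊆ Finset.Icc (F.min' hne) (F.min' hne + D) := by
      intro t ht
      have hmin := F.min'_mem hne
      have hle := F.min'_le t ht
      rw [Finset.mem_Icc]
      refine ⟨hle, ?_⟩
      rcases hle.lt_or_eq with hlt | heq
      · obtain ⟨h1, h2⟩ := Finset.mem_filter.1 hmin
        obtain ⟨h3, h4⟩ := Finset.mem_filter.1 ht
        have e1 := Nat.div_add_mod (F.min' hne) s₀
        have e2 := Nat.div_add_mod t s₀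
        have e3 := Nat.mod_lt t hs₀
        rw [h2] at e1
        rw [h4] at e2
        have := h _ h1 _ h3 hlt (by omega)
        omega
      · omega
    have hcard := Finset.card_le_card hsub
    rw [Nat.card_Icc] at hcard
    omega

/-- Pairs of points of `A` are at distance at most `d` or at least `s`. -/
def IsClustered (d s : ℝ) (A : Set ℝ) : Prop :=
  ∀ x ∈ A, ∀ y ∈ A, |x - y| ≤ d ∨ s ≤ |x - y|

open Classical in
/-- Indices of those of the first `B` consecutive intervals of length `ℓ`, starting at `a`,
which meet `A`. -/
noncomputable def hitIndices (A : Set ℝ) (a ℓ : ℝ) (B : ℕ) : Finset ℕ :=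
  {t ∈ Finset.range B | (A ∩ Icc (a + t * ℓ) (a + t * ℓ + ℓ)).Nonempty}

theorem mem_hitIndices {A : Set ℝ} {a ℓ : ℝ} {B t : ℕ} : t ∈ hitIndices A a ℓ B ↔
    t < B ∧ (A ∩ Icc (a + t * ℓ) (a + t * ℓ + ℓ)).Nonempty := by
  simp [hitIndices]

theorem card_hitIndices_le_aux {A : Set ℝ} {d s a ℓ : ℝ} {B s₀ : ℕ} (hA : IsClustered d s A)
    (hd : 0 ≤ d) (hℓ : 0 < ℓ) (hs₀ : 0 < s₀)
    (hs : ∀ t t' : ℕ, t < t' → t' < B → t' - t < s₀ → ((t' : ℝ) - t + 1) * ℓ < s) :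
    ((hitIndices A a ℓ B).card : ℝ) ≤ (d / ℓ + 2) * ((B / s₀ : ℕ) + 1) := by
  have hcard : (hitIndices A a ℓ B).card ≤ (⌊d / ℓ⌋₊ + 1 + 1) * (B / s₀ + 1) := by
    refine card_le_of_clustered hs₀
      (fun t ht => (mem_hitIndices.1 ht).1) ?_
    intro t ht t' ht' hlt hnear
    obtain ⟨h1, x, hxA, hx⟩ := mem_hitIndices.1 ht
    obtain ⟨h2, y, hyA, hy⟩ := mem_hitIndices.1 ht'
    have hlt' : (t : ℝ) + 1 ≤ t' := by exact_mod_cast hlt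
    have hxy : x ≤ y := by nlinarith [hx.2, hy.1]
    have h3 := hs t t' hlt h2 hnear
    have h4 : |x - y| ≤ d := (hA x hxA y hyA).resolve_right fun h => by
      rw [abs_sub_comm, abs_of_nonneg (by linarith)] at h
      nlinarith [hx.1, hy.2]
    rw [abs_sub_comm, abs_of_nonneg (by linarith)] at h4
    have h5 : t' - t - 1 ≤ ⌊d / ℓ⌋₊ := by
      refine Nat.le_floor ?_
      rw [le_div_iff₀ hℓ, Nat.cast_sub (by omega), Nat.cast_sub hlt.le]
      push_cast
      nlinarith [hx.2, hy.1]
    omega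
  have hfl := Nat.floor_le (div_nonneg hd hℓ.le)
  have hcast : ((hitIndices A a ℓ B).card : ℝ) ≤ (⌊d / ℓ⌋₊ + 1 + 1) * ((B / s₀ : ℕ) + 1) := by
    exact_mod_cast hcard
  refine hcast.trans (mul_le_mul_of_nonneg_right (by linarith) (by positivity))

theorem card_hitIndices_le_of_short {A : Set ℝ} {d s a ℓ : ℝ} {B : ℕ} (hA : IsClustered d s A)
    (hd : 0 ≤ d) (hℓ : 0 < ℓ) (hs : B * ℓ < s) :
    ((hitIndices A a ℓ B).card : ℝ) ≤ d / ℓ + 2 := by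
  have := card_hitIndices_le_aux (a := a) (B := B) (s₀ := B + 1) hA hd hℓ (by omega) ?_
  · rw [Nat.div_eq_of_lt (by omega)] at this
    simpa using this
  · intro t t' _ h2 _
    have h3 : (t' : ℝ) + 1 ≤ B := by exact_mod_cast h2
    have : (0 : ℝ) ≤ t := t.cast_nonneg
    nlinarith

theorem card_hitIndices_le {A : Set ℝ} {d s a ℓ : ℝ} {B : ℕ} (hA : IsClustered d s A)
    (hd : 0 ≤ d) (hℓ : 0 < ℓ) (hs : ℓ < s) :
    ((hitIndices A a ℓ B).card : ℝ) ≤ (d / ℓ + 2) * (2 * (B * ℓ) / s + 1) := by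
  have hs0 : 0 < s := hℓ.trans hs
  have hr : 1 < s / ℓ := by rwa [one_lt_div hℓ]
  have hceil : 1 < ⌈s / ℓ⌉₊ := by rw [Nat.lt_ceil]; simpa using hr
  have h1 : (⌈s / ℓ⌉₊ : ℝ) < s / ℓ + 1 := Nat.ceil_lt_add_one (by linarith)
  have h2 : s / ℓ ≤ ⌈s / ℓ⌉₊ := Nat.le_ceil _
  have hcast : ((⌈s / ℓ⌉₊ - 1 : ℕ) : ℝ) = ⌈s / ℓ⌉₊ - 1 := by
    rw [Nat.cast_sub hceil.le]; simp
  refine (card_hitIndices_le_aux (s₀ := ⌈s / ℓ⌉₊ - 1) hA hd hℓ (by omega) ?_).trans ?_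
  · intro t t' h3 h4 h5
    have h6 : t' + 1 ≤ ⌈s / ℓ⌉₊ - 1 + t := by omega
    have h7 : (t' : ℝ) + 1 ≤ (⌈s / ℓ⌉₊ - 1 : ℕ) + t := by exact_mod_cast h6
    rw [hcast] at h7
    rw [← lt_div_iff₀ hℓ]
    linarith
  · have h8 : (2 : ℝ) ≤ ⌈s / ℓ⌉₊ := by exact_mod_cast hceil
    have h9 : s / ℓ / 2 ≤ ((⌈s / ℓ⌉₊ - 1 : ℕ) : ℝ) := by rw [hcast]; linarith
    have h10 : ((B / (⌈s / ℓ⌉₊ - 1) : ℕ) : ℝ) ≤ B / (s / ℓ / 2) :=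
      Nat.cast_div_le.trans (div_le_div_of_nonneg_left (by positivity) (by positivity) h9)
    have h11 : (B : ℝ) / (s / ℓ / 2) = 2 * (B * ℓ) / s := by field_simp
    have : 0 ≤ d / ℓ := by positivity
    exact mul_le_mul_of_nonneg_left (by linarith) (by linarith)

open Classical in
/-- The part of the gap family `A` at levels `< L * n` that can still damage the interval
`[a, a + ℓ]` of generation `n` is small: it misses all the large gaps, and the total length of
the small ones that it meets is at most `ℓ / 16`. -/
def IsGoodNode (q : ℝ) (k M L : ℕ) (A : ℕ → ℕ → Set ℝ) (n : ℕ) (a : ℝ) : Prop :=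
  (∀ i < M, ∀ j, j + k ≤ L * n → ¬(A i j ∩ Icc a (a + 1 / 4 / (q ^ L) ^ n)).Nonempty) ∧
    ∑ i ∈ Finset.range M, ∑ j ∈ Finset.Ico (L * n + 1 - k) (L * n),
      (if (A i j ∩ Icc a (a + 1 / 4 / (q ^ L) ^ n)).Nonempty then (q ^ (k + j))⁻¹ else 0) ≤
        1 / 4 / (q ^ L) ^ n / 16

section counting

variable {q : ℝ} {k L n j B : ℕ} {A : Set ℝ} {a : ℝ}

theorem card_hitIndices_old (hq : 1 < q) (hB : (B : ℝ) ≤ q ^ L)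
    (hA : IsClustered (q ^ (k + j))⁻¹ ((q ^ j)⁻¹ / 2) A) (hj : j ≤ L * n)
    (hkj : k + j ≤ L * (n + 1)) :
    ((hitIndices A a (1 / 4 / (q ^ L) ^ (n + 1)) B).card : ℝ) ≤
      3 / (1 / 4 / (q ^ L) ^ (n + 1)) * (q ^ (k + j))⁻¹ := by
  have hq0 : 0 < q := by linarith
  have h1 : q ^ (k + j) ≤ (q ^ L) ^ (n + 1) := by
    rw [← pow_mul]; exact pow_le_pow_right₀ hq.le hkj
  have h2 : ((q ^ L) ^ n)⁻¹ ≤ (q ^ j)⁻¹ := by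
    rw [← pow_mul]; exact inv_anti₀ (by positivity) (pow_le_pow_right₀ hq.le hj)
  have h3 : 0 < ((q ^ L) ^ n)⁻¹ := by positivity
  have hshort : B * (1 / 4 / (q ^ L) ^ (n + 1)) < (q ^ j)⁻¹ / 2 := by
    calc B * (1 / 4 / (q ^ L) ^ (n + 1)) ≤ q ^ L * (1 / 4 / (q ^ L) ^ (n + 1)) := by gcongr
      _ = ((q ^ L) ^ n)⁻¹ / 4 := by rw [pow_succ]; field_simp
      _ < _ := by linarith
  refine (card_hitIndices_le_of_short hA (by positivity) (by positivity) hshort).trans ?_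
  have h4 : 1 ≤ (q ^ (k + j))⁻¹ * (q ^ L) ^ (n + 1) := by
    rw [inv_mul_eq_div, one_le_div (by positivity)]; exact h1
  have h5 : (q ^ (k + j))⁻¹ / (1 / 4 / (q ^ L) ^ (n + 1)) =
      4 * ((q ^ (k + j))⁻¹ * (q ^ L) ^ (n + 1)) := by field_simp
  have h6 : 3 / (1 / 4 / (q ^ L) ^ (n + 1)) * (q ^ (k + j))⁻¹ =
      12 * ((q ^ (k + j))⁻¹ * (q ^ L) ^ (n + 1)) := by field_simp; norm_num
  rw [h5, h6]
  linarith

theorem card_hitIndices_new (hq : 1 < q) (hB : (B : ℝ) ≤ q ^ L)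
    (hA : IsClustered (q ^ (k + j))⁻¹ ((q ^ j)⁻¹ / 2) A) (hj : L * n ≤ j)
    (hj' : j ≤ L * (n + 1)) :
    ((hitIndices A a (1 / 4 / (q ^ L) ^ (n + 1)) B).card : ℝ) ≤
      (4 * ((q ^ (k + j))⁻¹ * (q ^ L) ^ (n + 1)) + 2) * (2 * (q ^ j / (q ^ L) ^ n)) := by
  have hq0 : 0 < q := by linarith
  have h1 : ((q ^ L) ^ (n + 1))⁻¹ ≤ (q ^ j)⁻¹ := by
    rw [← pow_mul]; exact inv_anti₀ (by positivity) (pow_le_pow_right₀ hq.le hj')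
  have h2 : (q ^ L) ^ n ≤ q ^ j := by
    rw [← pow_mul]; exact pow_le_pow_right₀ hq.le hj
  have h3 : 0 < ((q ^ L) ^ (n + 1))⁻¹ := by positivity
  have h4 : 1 / 4 / (q ^ L) ^ (n + 1) = ((q ^ L) ^ (n + 1))⁻¹ / 4 := by field_simp
  refine (card_hitIndices_le hA (by positivity) (by positivity)
    (by rw [h4]; linarith)).trans ?_
  have h5 : (q ^ (k + j))⁻¹ / (1 / 4 / (q ^ L) ^ (n + 1)) =
      4 * ((q ^ (k + j))⁻¹ * (q ^ L) ^ (n + 1)) := by field_simp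
  have h6 : 2 * (B * (1 / 4 / (q ^ L) ^ (n + 1))) / ((q ^ j)⁻¹ / 2) ≤ q ^ j / (q ^ L) ^ n := by
    calc 2 * (B * (1 / 4 / (q ^ L) ^ (n + 1))) / ((q ^ j)⁻¹ / 2)
        ≤ 2 * (q ^ L * (1 / 4 / (q ^ L) ^ (n + 1))) / ((q ^ j)⁻¹ / 2) := by gcongr
      _ = q ^ j / (q ^ L) ^ n := by rw [pow_succ]; field_simp; norm_num
  have h7 : 1 ≤ q ^ j / (q ^ L) ^ n := by rwa [one_le_div (by positivity)]
  rw [h5]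
  refine mul_le_mul_of_nonneg_left (by linarith) (by positivity)

theorem card_hitIndices_large (hq : 1 < q) (hB : (B : ℝ) ≤ q ^ L)
    (hA : IsClustered (q ^ (k + j))⁻¹ ((q ^ j)⁻¹ / 2) A) (hj : L * n ≤ j)
    (hkj : k + j ≤ L * (n + 1)) :
    ((hitIndices A a (1 / 4 / (q ^ L) ^ (n + 1)) B).card : ℝ) ≤ 12 / q ^ k * q ^ L := by
  have hq0 : 0 < q := by linarith
  refine (card_hitIndices_new hq hB hA hj (by omega)).trans ?_
  have h1 : q ^ (k + j) ≤ (q ^ L) ^ (n + 1) := by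
    rw [← pow_mul]; exact pow_le_pow_right₀ hq.le hkj
  have h4 : 1 ≤ (q ^ (k + j))⁻¹ * (q ^ L) ^ (n + 1) := by
    rw [inv_mul_eq_div, one_le_div (by positivity)]; exact h1
  calc (4 * ((q ^ (k + j))⁻¹ * (q ^ L) ^ (n + 1)) + 2) * (2 * (q ^ j / (q ^ L) ^ n))
      ≤ (6 * ((q ^ (k + j))⁻¹ * (q ^ L) ^ (n + 1))) * (2 * (q ^ j / (q ^ L) ^ n)) :=
        mul_le_mul_of_nonneg_right (by linarith) (by positivity)
    _ = 12 / q ^ k * q ^ L := by rw [pow_add, pow_succ]; field_simp; norm_num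

theorem card_hitIndices_small (hq : 1 < q) (hB : (B : ℝ) ≤ q ^ L)
    (hA : IsClustered (q ^ (k + j))⁻¹ ((q ^ j)⁻¹ / 2) A) (hj : L * n ≤ j)
    (hj' : j ≤ L * (n + 1)) (hkj : L * (n + 1) ≤ k + j) :
    (q ^ (k + j))⁻¹ * ((hitIndices A a (1 / 4 / (q ^ L) ^ (n + 1)) B).card : ℝ) ≤
      48 / q ^ k * q ^ L * (1 / 4 / (q ^ L) ^ (n + 1)) := by
  have hq0 : 0 < q := by linarith
  have h1 : (q ^ L) ^ (n + 1) ≤ q ^ (k + j) := by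
    rw [← pow_mul]; exact pow_le_pow_right₀ hq.le hkj
  have h4 : (q ^ (k + j))⁻¹ * (q ^ L) ^ (n + 1) ≤ 1 := by
    rw [inv_mul_eq_div, div_le_one (by positivity)]; exact h1
  calc _ ≤ (q ^ (k + j))⁻¹ *
        ((4 * ((q ^ (k + j))⁻¹ * (q ^ L) ^ (n + 1)) + 2) * (2 * (q ^ j / (q ^ L) ^ n))) := by
        gcongr; exact card_hitIndices_new hq hB hA hj hj'
    _ ≤ (q ^ (k + j))⁻¹ * (6 * (2 * (q ^ j / (q ^ L) ^ n))) := by gcongr; linarith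
    _ = _ := by rw [pow_add, pow_succ]; field_simp; norm_num

end counting

open Classical in
theorem card_goodChildren {q : ℝ} {k M L B n : ℕ} {A : ℕ → ℕ → Set ℝ} {a : ℝ} (hq : 1 < q)
    (hk : 0 < k) (hkL : k ≤ L) (hB : (B : ℝ) ≤ q ^ L) (hB' : q ^ L ≤ B + 1) (hL : 16 ≤ q ^ L)
    (h1 : 512 * (M * L : ℝ) ≤ q ^ k) (h2 : 16384 * (k * M : ℝ) ≤ q ^ k)
    (hA : ∀ i < M, ∀ j, IsClustered (q ^ (k + j))⁻¹ ((q ^ j)⁻¹ / 2) (A i j))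
    (ha : IsGoodNode q k M L A n a) :
    q ^ L / 2 ≤ ((Finset.range B).filter fun t : ℕ =>
      IsGoodNode q k M L A (n + 1) (a + t * (1 / 4 / (q ^ L) ^ (n + 1)))).card := by
  have hq0 : 0 < q := by linarith
  set ℓ := 1 / 4 / (q ^ L) ^ (n + 1) with hℓ
  have hℓ0 : 0 < ℓ := by positivity
  have hℓn : 1 / 4 / (q ^ L) ^ n = q ^ L * ℓ := by rw [hℓ, pow_succ]; field_simp
  have hLn : L * (n + 1) = L * n + L := by ring
  set H : ℕ → ℕ → Finset ℕ := fun i j => hitIndices (A i j) a ℓ B with hH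
  set old := (Finset.range M).biUnion fun i =>
    (Finset.Ico (L * n + 1 - k) (L * n)).biUnion fun j => H i j with hold
  set new := (Finset.range M).biUnion fun i =>
    (Finset.Ico (L * n) (L * (n + 1) + 1 - k)).biUnion fun j => H i j with hnew
  set W : ℕ → ℝ := fun t => ∑ i ∈ Finset.range M,
    ∑ j ∈ Finset.Ico (L * (n + 1) + 1 - k) (L * (n + 1)),
      (if t ∈ H i j then (q ^ (k + j))⁻¹ else 0) with hW
  set heavy := (Finset.range B).filter fun t => ℓ / 16 < W t with hheavy
  have hsub : ∀ t < B, Icc (a + t * ℓ) (a + t * ℓ + ℓ) ⊆ Icc a (a + 1 / 4 / (q ^ L) ^ n) := by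
    intro t ht
    have h3 : (t : ℝ) + 1 ≤ B := by exact_mod_cast ht
    have h4 : (0 : ℝ) ≤ t := t.cast_nonneg
    refine Icc_subset_Icc ?_ ?_
    · have := mul_nonneg h4 hℓ0.le
      linarith
    · rw [hℓn]
      nlinarith
  have hcover : Finset.range B ⊆ ((Finset.range B).filter fun t : ℕ =>
      IsGoodNode q k M L A (n + 1) (a + t * ℓ)) ∪ (old ∪ (new ∪ heavy)) := by
    intro t ht
    by_contra hcon
    simp only [Finset.mem_union, not_or] at hcon
    obtain ⟨c1, c2, c3, c4⟩ := hcon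
    refine c1 (Finset.mem_filter.2 ⟨ht, ?_, ?_⟩)
    · intro i hi j hj hne
      have htH : t ∈ H i j := mem_hitIndices.2 ⟨Finset.mem_range.1 ht, hne⟩
      by_cases hj1 : j + k ≤ L * n
      · obtain ⟨x, hx1, hx2⟩ := hne
        exact ha.1 i hi j hj1 ⟨x, hx1, hsub t (Finset.mem_range.1 ht) hx2⟩
      by_cases hj2 : j < L * n
      · exact c2 (Finset.mem_biUnion.2 ⟨i, Finset.mem_range.2 hi, Finset.mem_biUnion.2
          ⟨j, Finset.mem_Ico.2 ⟨by omega, hj2⟩, htH⟩⟩)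
      · exact c3 (Finset.mem_biUnion.2 ⟨i, Finset.mem_range.2 hi, Finset.mem_biUnion.2
          ⟨j, Finset.mem_Ico.2 ⟨by omega, by omega⟩, htH⟩⟩)
    · have h5 : W t ≤ ℓ / 16 := by
        by_contra h
        exact c4 (Finset.mem_filter.2 ⟨ht, not_le.1 h⟩)
      refine le_trans (le_of_eq ?_) h5
      refine Finset.sum_congr rfl fun i _ => Finset.sum_congr rfl fun j _ => ?_
      have : t ∈ H i j ↔ (A i j ∩ Icc (a + t * ℓ) (a + t * ℓ + ℓ)).Nonempty := by
        rw [hH, mem_hitIndices, and_iff_right (Finset.mem_range.1 ht)]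
      simp only [this, hℓ]
  have hcardold : (old.card : ℝ) ≤ 3 / 16 * q ^ L := by
    calc (old.card : ℝ) ≤ ∑ i ∈ Finset.range M, ∑ j ∈ Finset.Ico (L * n + 1 - k) (L * n),
          ((H i j).card : ℝ) := by
          refine (Nat.cast_le.2 Finset.card_biUnion_le).trans ?_
          rw [Nat.cast_sum]
          refine Finset.sum_le_sum fun i _ => (Nat.cast_le.2 Finset.card_biUnion_le).trans ?_
          rw [Nat.cast_sum]
      _ ≤ ∑ i ∈ Finset.range M, ∑ j ∈ Finset.Ico (L * n + 1 - k) (L * n),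
          3 / ℓ * (if (A i j ∩ Icc a (a + 1 / 4 / (q ^ L) ^ n)).Nonempty
            then (q ^ (k + j))⁻¹ else 0) := by
          refine Finset.sum_le_sum fun i hi => Finset.sum_le_sum fun j hj => ?_
          rw [Finset.mem_Ico] at hj
          split_ifs with hne
          · exact card_hitIndices_old hq hB (hA i (Finset.mem_range.1 hi) j) hj.2.le (by omega)
          · rw [mul_zero, Nat.cast_nonpos, Finset.card_eq_zero, Finset.eq_empty_iff_forall_notMem]
            intro t ht
            obtain ⟨ht1, x, hx1, hx2⟩ := mem_hitIndices.1 ht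
            exact hne ⟨x, hx1, hsub t ht1 hx2⟩
      _ ≤ 3 / ℓ * (q ^ L * ℓ / 16) := by
          simp only [← Finset.mul_sum]
          refine mul_le_mul_of_nonneg_left ?_ (by positivity)
          rw [← hℓn]
          exact ha.2
      _ = _ := by field_simp
  have hcardnew : (new.card : ℝ) ≤ 1 / 16 * q ^ L := by
    calc (new.card : ℝ) ≤ ∑ i ∈ Finset.range M,
          ∑ j ∈ Finset.Ico (L * n) (L * (n + 1) + 1 - k), ((H i j).card : ℝ) := by
          refine (Nat.cast_le.2 Finset.card_biUnion_le).trans ?_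
          rw [Nat.cast_sum]
          refine Finset.sum_le_sum fun i _ => (Nat.cast_le.2 Finset.card_biUnion_le).trans ?_
          rw [Nat.cast_sum]
      _ ≤ ∑ i ∈ Finset.range M, ∑ j ∈ Finset.Ico (L * n) (L * (n + 1) + 1 - k),
          12 / q ^ k * q ^ L := by
          refine Finset.sum_le_sum fun i hi => Finset.sum_le_sum fun j hj => ?_
          rw [Finset.mem_Ico] at hj
          exact card_hitIndices_large hq hB (hA i (Finset.mem_range.1 hi) j) hj.1 (by omega)
      _ = M * (L + 1 - k : ℕ) * (12 / q ^ k * q ^ L) := by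
          rw [Finset.sum_const, Finset.sum_const, Finset.card_range, Nat.card_Ico,
            show L * (n + 1) + 1 - k - L * n = L + 1 - k by omega]
          simp only [nsmul_eq_mul]
          ring
      _ ≤ M * L * (12 / q ^ k * q ^ L) := by
          gcongr
          omega
      _ = 12 * (M * L) / q ^ k * q ^ L := by ring
      _ ≤ _ := by
          refine mul_le_mul_of_nonneg_right ?_ (by positivity)
          rw [div_le_iff₀ (by positivity)]
          have : (0 : ℝ) ≤ M * L := by positivity
          linarith
  have hcardheavy : (heavy.card : ℝ) ≤ 1 / 16 * q ^ L := by
    have hW0 : ∀ t, 0 ≤ W t := fun t =>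
      Finset.sum_nonneg fun i _ => Finset.sum_nonneg fun j _ => by split_ifs <;> positivity
    have e1 : (heavy.card : ℝ) * (ℓ / 16) ≤ ∑ t ∈ Finset.range B, W t := by
      rw [← nsmul_eq_mul]
      refine (Finset.card_nsmul_le_sum heavy W _ fun t ht =>
        (Finset.mem_filter.1 ht).2.le).trans ?_
      exact Finset.sum_le_sum_of_subset_of_nonneg (Finset.filter_subset _ _) fun t _ _ => hW0 t
    have e2 : ∑ t ∈ Finset.range B, W t = ∑ i ∈ Finset.range M,
        ∑ j ∈ Finset.Ico (L * (n + 1) + 1 - k) (L * (n + 1)),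
          (q ^ (k + j))⁻¹ * ((H i j).card : ℝ) := by
      rw [hW, Finset.sum_comm]
      refine Finset.sum_congr rfl fun i _ => ?_
      rw [Finset.sum_comm]
      refine Finset.sum_congr rfl fun j _ => ?_
      rw [← Finset.sum_filter, Finset.sum_const, nsmul_eq_mul, mul_comm]
      congr 3
      ext t
      simp only [Finset.mem_filter, Finset.mem_range, hH, mem_hitIndices]
      tauto
    have e3 : ∑ t ∈ Finset.range B, W t ≤ M * k * (48 / q ^ k * q ^ L * ℓ) := by
      rw [e2]
      calc _ ≤ ∑ i ∈ Finset.range M,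
          ∑ j ∈ Finset.Ico (L * (n + 1) + 1 - k) (L * (n + 1)), 48 / q ^ k * q ^ L * ℓ := by
            refine Finset.sum_le_sum fun i hi => Finset.sum_le_sum fun j hj => ?_
            rw [Finset.mem_Ico] at hj
            exact card_hitIndices_small hq hB (hA i (Finset.mem_range.1 hi) j) (by omega)
              (by omega) (by omega)
        _ = M * (L * (n + 1) - (L * (n + 1) + 1 - k) : ℕ) * (48 / q ^ k * q ^ L * ℓ) := by
            rw [Finset.sum_const, Finset.sum_const, Finset.card_range, Nat.card_Ico]
            simp only [nsmul_eq_mul]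
            ring
        _ ≤ _ := by
            gcongr
            omega
    have e4 : (heavy.card : ℝ) * (ℓ / 16) ≤ (768 * (k * M) / q ^ k * q ^ L) * (ℓ / 16) :=
      (e1.trans e3).trans_eq (by ring)
    refine (le_of_mul_le_mul_right e4 (by positivity)).trans ?_
    refine mul_le_mul_of_nonneg_right ?_ (by positivity)
    rw [div_le_iff₀ (by positivity)]
    have : (0 : ℝ) ≤ k * M := by positivity
    linarith
  have htotal := (Finset.card_le_card hcover).trans ((Finset.card_union_le _ _).trans
    (Nat.add_le_add_left ((Finset.card_union_le _ _).trans
      (Nat.add_le_add_left (Finset.card_union_le _ _) _)) _))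
  rw [Finset.card_range] at htotal
  have htotal' : (B : ℝ) ≤ ((Finset.range B).filter fun t : ℕ =>
      IsGoodNode q k M L A (n + 1) (a + t * ℓ)).card + (old.card + (new.card + heavy.card)) := by
    exact_mod_cast htotal
  linarith

/-- Points avoiding `M` sparse families of gaps form a set of nearly full dimension. -/
theorem le_dimH_avoid {q a₀ : ℝ} {k M : ℕ} {A : ℕ → ℕ → Set ℝ} (hq : 3 / 2 ≤ q) (hk : 4 ≤ k)
    (hM : 0 < M) (hkM : 16384 * (k * M : ℝ) ≤ q ^ k)
    (hA : ∀ i < M, ∀ j, IsClustered (q ^ (k + j))⁻¹ ((q ^ j)⁻¹ / 2) (A i j)) :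
    ENNReal.ofReal (1 - 4096 * M / q ^ k) ≤
      dimH {x | x ∈ Icc a₀ (a₀ + 1 / 4) ∧ ∀ i < M, ∀ j, x ∉ A i j} := by
  classical
  have hq0 : 0 < q := by linarith
  have hq1 : 1 < q := by linarith
  have hM0 : (0 : ℝ) < M := by exact_mod_cast hM
  have hk0 : (4 : ℝ) ≤ k := by exact_mod_cast hk
  set L := ⌊q ^ k / (512 * M)⌋₊ with hL
  have hr : (k : ℝ) ≤ q ^ k / (512 * M) := by
    rw [le_div_iff₀ (by positivity)]
    nlinarith [mul_pos hM0 (by linarith : (0 : ℝ) < k)]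
  have hkL : k ≤ L := Nat.le_floor hr
  have hL1 : (L : ℝ) ≤ q ^ k / (512 * M) := Nat.floor_le (by positivity)
  have hL2 : q ^ k / (512 * M) < L + 1 := Nat.lt_floor_add_one _
  have hkL' : (k : ℝ) ≤ L := by exact_mod_cast hkL
  have h512 : 512 * (M * L : ℝ) ≤ q ^ k := by
    rw [le_div_iff₀ (by positivity)] at hL1
    linarith
  have hX : 16 ≤ q ^ L := by
    have h1 : (65536 : ℝ) ≤ q ^ k := by
      have : (1 : ℝ) ≤ M := by exact_mod_cast hM
      nlinarith
    have h2 : q ^ k ≤ q ^ L := pow_le_pow_right₀ (by linarith) hkL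
    linarith
  have hX0 : 0 < q ^ L := by positivity
  set B := ⌊q ^ L⌋₊ with hBdef
  set b := ⌊q ^ L / 2⌋₊ with hbdef
  have hb1 : (b : ℝ) ≤ q ^ L / 2 := Nat.floor_le (by positivity)
  have hb2 : q ^ L / 2 < b + 1 := Nat.lt_floor_add_one _
  have hb4 : q ^ L / 4 ≤ b := by linarith
  have hb : 2 ≤ b := Nat.le_floor (by push_cast; linarith)
  have hB : (B : ℝ) ≤ q ^ L := Nat.floor_le hX0.le
  have hB' : q ^ L ≤ B + 1 := (Nat.lt_floor_add_one _).le
  have hdim := le_dimH_of_branching (Q := q ^ L) (ℓ₀ := 1 / 4) (a₀ := a₀) (b := b) (B := B)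
    (E := {x | x ∈ Icc a₀ (a₀ + 1 / 4) ∧ ∀ i < M, ∀ j, x ∉ A i j})
    (by linarith) (by norm_num) hb hB
    (fun n a => IsGoodNode q k M L A n a ∧ (n = 0 → a = a₀)) ?_ ?_ ?_
  · refine le_trans (ENNReal.ofReal_le_ofReal ?_) hdim
    have hlogq : 0 < Real.log q := Real.log_pos hq1
    have hL0 : (0 : ℝ) < L := by linarith
    have hlog4 : Real.log 4 ≤ 4 * Real.log q := by
      rw [show 4 * Real.log q = Real.log (q ^ 4) by rw [Real.log_pow]; norm_num]
      refine Real.log_le_log (by norm_num) ?_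
      calc (4 : ℝ) ≤ (3 / 2) ^ 4 := by norm_num
        _ ≤ q ^ 4 := by gcongr
    have hlogb : L * Real.log q - Real.log 4 ≤ Real.log b := by
      rw [← Real.log_pow, ← Real.log_div hX0.ne' (by norm_num)]
      exact Real.log_le_log (by positivity) hb4
    rw [Real.log_pow, le_div_iff₀ (by positivity)]
    have h4 : 4 ≤ 4096 * M / q ^ k * L := by
      rw [div_lt_iff₀ (by positivity)] at hL2
      rw [div_mul_eq_mul_div, le_div_iff₀ (by positivity)]
      nlinarith
    nlinarith
  · refine ⟨⟨fun i _ j hj => by omega, by simp; norm_num⟩, fun _ => rfl⟩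
  · rintro n a ⟨ha, -⟩
    have hcard := card_goodChildren hq1 (by omega) hkL hB hB' hX h512 hkM hA ha
    set S := (Finset.range B).filter fun t : ℕ =>
      IsGoodNode q k M L A (n + 1) (a + t * (1 / 4 / (q ^ L) ^ (n + 1))) with hS
    have hbS : b ≤ S.card := by exact_mod_cast hb1.trans hcard
    have hmem : ∀ i, S.orderEmbOfCardLe hbS i ∈ S := S.orderEmbOfCardLe_mem hbS
    refine ⟨fun i => if h : i < b then S.orderEmbOfCardLe hbS ⟨i, h⟩ else 0, ?_, ?_⟩
    · intro i hi
      obtain ⟨h3, h4⟩ := Finset.mem_filter.1 (hmem ⟨i, hi⟩)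
      simp only [hi, dif_pos]
      exact ⟨Finset.mem_range.1 h3, h4, fun h => absurd h n.succ_ne_zero⟩
    · intro i j hij hj
      simp only [hj, hij.trans hj, dif_pos]
      exact (S.orderEmbOfCardLe hbS).strictMono hij
  · intro x hx
    refine ⟨?_, fun i hi j hxA => ?_⟩
    · obtain ⟨a, ⟨-, ha⟩, hxa⟩ := hx 0
      simpa [ha rfl] using hxa
    · obtain ⟨a, ⟨ha, -⟩, hxa⟩ := hx (j + k)
      exact ha.1 i hi j (Nat.le_mul_of_pos_left _ (by omega)) ⟨x, hxA, hxa⟩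
/-- The sequence `d, a 0, a 1, …`. -/
def consSeq (d : ℝ) (a : ℕ → ℝ) : ℕ → ℝ
  | 0 => d
  | n + 1 => a n

theorem consSeq_injective (d : ℝ) : Function.Injective (consSeq d) := fun a b h => by
  funext n
  exact congrFun h (n + 1)

theorem IsDigitSeq.nonneg {a : ℕ → ℝ} (ha : IsDigitSeq a) (j : ℕ) : 0 ≤ a j := by
  rcases ha j with h | h <;> simp [h]

theorem IsDigitSeq.le_one {a : ℕ → ℝ} (ha : IsDigitSeq a) (j : ℕ) : a j ≤ 1 := by
  rcases ha j with h | h <;> simp [h]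

theorem IsDigitSeq.cons {a : ℕ → ℝ} (ha : IsDigitSeq a) {d : ℝ} (hd : d = 0 ∨ d = 1) :
    IsDigitSeq (consSeq d a) := by
  rintro (_ | n)
  exacts [hd, ha n]

theorem hasSum_one_div_pow_succ {q : ℝ} (hq : 1 < q) :
    HasSum (fun j : ℕ => 1 / q ^ (j + 1)) (1 / (q - 1)) := by
  have hq0 : q ≠ 0 := by linarith
  have h := (hasSum_geometric_of_lt_one (inv_nonneg.2 (by linarith))
    (inv_lt_one_of_one_lt₀ hq)).mul_left q⁻¹
  rw [← mul_inv, mul_sub, mul_one, mul_inv_cancel₀ hq0] at h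
  simpa [pow_succ', one_div, mul_comm] using h

theorem IsDigitSeq.summable {q : ℝ} (hq : 1 < q) {a : ℕ → ℝ} (ha : IsDigitSeq a) :
    Summable fun j : ℕ => a j / q ^ (j + 1) := by
  have hq0 : 0 < q := by linarith
  refine (hasSum_one_div_pow_succ hq).summable.of_nonneg_of_le
    (fun j => div_nonneg (ha.nonneg j) (by positivity)) fun j => ?_
  gcongr
  exact ha.le_one j

theorem IsDigitSeq.piQ_mem_Iq {q : ℝ} (hq : 1 < q) {a : ℕ → ℝ} (ha : IsDigitSeq a) :
    piQ q a ∈ Iq q := by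
  have hq0 : 0 < q := by linarith
  refine ⟨tsum_nonneg fun j => div_nonneg (ha.nonneg j) (by positivity), ?_⟩
  rw [← (hasSum_one_div_pow_succ hq).tsum_eq]
  refine (ha.summable hq).tsum_le_tsum (fun j => ?_) (hasSum_one_div_pow_succ hq).summable
  gcongr
  exact ha.le_one j

theorem IsDigitSeq.piQ_cons {q : ℝ} (hq : 1 < q) {a : ℕ → ℝ} (ha : IsDigitSeq a) {d : ℝ}
    (hd : d = 0 ∨ d = 1) : piQ q (consSeq d a) = (d + piQ q a) / q := by
  rw [piQ, ((ha.cons hd).summable hq).tsum_eq_zero_add, piQ, add_div, ← tsum_div_const]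
  congr 1
  · simp [consSeq]
  · refine tsum_congr fun j => ?_
    rw [consSeq, div_div, ← pow_succ]

theorem mem_Iq_of_encard_ne_zero {q x : ℝ} (hq : 1 < q) (h : (SigmaSet q x).encard ≠ 0) :
    x ∈ Iq q := by
  obtain ⟨a, ha, rfl⟩ := encard_ne_zero.1 h
  exact ha.piQ_mem_Iq hq

theorem encard_SigmaSet_of_notMem {q x : ℝ} (hq : 1 < q) (h : x ∉ Iq q) :
    (SigmaSet q x).encard = 0 := by
  by_contra h'
  exact h (mem_Iq_of_encard_ne_zero hq h')

theorem SigmaSet_eq_union {q : ℝ} (hq : 1 < q) (x : ℝ) :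
    SigmaSet q x = consSeq 0 '' SigmaSet q (q * x) ∪ consSeq 1 '' SigmaSet q (q * x - 1) := by
  have hq0 : q ≠ 0 := by linarith
  ext a
  constructor
  · rintro ⟨ha, rfl⟩
    have hs : IsDigitSeq fun n => a (n + 1) := fun n => ha _
    have hc : consSeq (a 0) (fun n => a (n + 1)) = a := by
      funext n; cases n <;> rfl
    have h := hs.piQ_cons hq (ha 0)
    rw [hc, eq_div_iff hq0] at h
    rcases ha 0 with h0 | h0
    · exact Or.inl ⟨_, ⟨hs, by linarith⟩, by rw [← h0, hc]⟩
    · exact Or.inr ⟨_, ⟨hs, by linarith⟩, by rw [← h0, hc]⟩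
  · rintro (⟨b, ⟨hb, hbx⟩, rfl⟩ | ⟨b, ⟨hb, hbx⟩, rfl⟩)
    · refine ⟨hb.cons (Or.inl rfl), ?_⟩
      rw [hb.piQ_cons hq (Or.inl rfl), hbx]
      field_simp
      ring
    · refine ⟨hb.cons (Or.inr rfl), ?_⟩
      rw [hb.piQ_cons hq (Or.inr rfl), hbx]
      field_simp
      ring

theorem encard_SigmaSet {q : ℝ} (hq : 1 < q) (x : ℝ) :
    (SigmaSet q x).encard = (SigmaSet q (q * x)).encard + (SigmaSet q (q * x - 1)).encard := by
  rw [SigmaSet_eq_union hq, encard_union_eq, (consSeq_injective 0).encard_image,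
    (consSeq_injective 1).encard_image]
  rw [disjoint_left]
  rintro _ ⟨b, -, rfl⟩ ⟨c, -, h⟩
  simpa [consSeq] using congrFun h 0

theorem encard_SigmaSet_div {q y : ℝ} (hq : 1 < q) :
    (SigmaSet q (y / q)).encard = (SigmaSet q y).encard + (SigmaSet q (y - 1)).encard := by
  rw [encard_SigmaSet hq, mul_div_cancel₀ _ (by linarith)]

theorem encard_SigmaSet_div_pow {q y : ℝ} (hq : 1 < q) (h0 : 0 ≤ y) (h1 : y < 1) (n : ℕ) :
    (SigmaSet q (y / q ^ n)).encard = (SigmaSet q y).encard := by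
  induction n with
  | zero => simp
  | succ n ih =>
    have : y / q ^ n ≤ y := div_le_self h0 (one_le_pow₀ hq.le)
    rw [pow_succ, ← div_div, encard_SigmaSet_div hq, ih,
      encard_SigmaSet_of_notMem hq (x := y / q ^ n - 1) (fun h => by linarith [h.1]), add_zero]

theorem encard_SigmaSet_sub_div_pow {q y : ℝ} (hq : 1 < q) (h0 : 0 ≤ 1 / (q - 1) - y)
    (h1 : 1 / (q - 1) - y < 1) (n : ℕ) :
    (SigmaSet q (1 / (q - 1) - (1 / (q - 1) - y) / q ^ n)).encard = (SigmaSet q y).encard := by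
  induction n with
  | zero => simp
  | succ n ih =>
    set c := 1 / (q - 1) with hc
    have hcq : c * (q - 1) = 1 := by rw [hc, one_div_mul_cancel (by linarith)]
    have : (c - y) / q ^ n ≤ c - y := div_le_self h0 (one_le_pow₀ hq.le)
    have hstep : c - (c - y) / q ^ (n + 1) = (c - (c - y) / q ^ n + 1) / q := by
      rw [eq_div_iff (by linarith), sub_mul, pow_succ, ← div_div, div_mul_cancel₀ _ (by linarith)]
      linarith
    rw [hstep, encard_SigmaSet_div hq, add_sub_cancel_right, ih,
      encard_SigmaSet_of_notMem hq (fun h => by linarith [h.2]), zero_add]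

theorem one_div_mul_sub_one (q : ℝ) : 1 / (q * (q - 1)) = 1 / (q - 1) / q := by
  rw [div_div, mul_comm]

/-- The digit `0` to the left of the switch region and the digit `1` otherwise. -/
noncomputable def digit (q y : ℝ) : ℝ := if y < 1 / q then 0 else 1

/-- One step of the expansion algorithm which chooses digits according to `digit`. -/
noncomputable def digitMap (q y : ℝ) : ℝ := q * y - digit q y

/-- The points whose orbit under `digitMap q` enters the switch region for the first time at
time `n`. -/
def switchSet (q : ℝ) : ℕ → Set ℝ
  | 0 => Jq q
  | n + 1 => {y | y ∉ Jq q ∧ digitMap q y ∈ switchSet q n}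

theorem digit_of_lt {q y : ℝ} (h : y < 1 / q) : digit q y = 0 := if_pos h

theorem digit_of_le {q y : ℝ} (h : 1 / q ≤ y) : digit q y = 1 := if_neg h.not_gt

theorem digitMap_of_lt {q y : ℝ} (h : y < 1 / q) : digitMap q y = q * y := by
  rw [digitMap, digit_of_lt h, sub_zero]

theorem digitMap_of_le {q y : ℝ} (h : 1 / q ≤ y) : digitMap q y = q * y - 1 := by
  rw [digitMap, digit_of_le h]

theorem digit_eq (q y : ℝ) : digit q y = 0 ∨ digit q y = 1 := by
  unfold digit
  split_ifs <;> simp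

theorem digitMap_mem_Iq {q y : ℝ} (hq : q ∈ Ioo (1 : ℝ) 2) (hy : y ∈ Iq q) (hJ : y ∉ Jq q) :
    digitMap q y ∈ Iq q ∧ ∀ d, d = 0 ∨ d = 1 → q * y - d ∈ Iq q → d = digit q y := by
  obtain ⟨hq1, hq2⟩ := hq
  have hq0 : 0 < q := by linarith
  have hcq : 1 / (q - 1) * (q - 1) = 1 := one_div_mul_cancel (by linarith)
  have hc : 1 < 1 / (q - 1) := by rw [lt_div_iff₀] <;> linarith
  obtain ⟨h0, h1⟩ := hy
  rcases lt_or_ge y (1 / q) with h | h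
  · have h' := (lt_div_iff₀' hq0).1 h
    rw [digitMap_of_lt h]
    refine ⟨⟨by positivity, by linarith⟩, ?_⟩
    rintro d (rfl | rfl) ⟨h2, h3⟩
    · exact (digit_of_lt h).symm
    · linarith
  · have h' := (div_le_iff₀' hq0).1 h
    have h4 : 1 / (q - 1) < q * y := by
      by_contra! h5
      exact hJ ⟨h, by rwa [one_div_mul_sub_one, le_div_iff₀' hq0]⟩
    rw [digitMap_of_le h]
    refine ⟨⟨by linarith, by nlinarith⟩, ?_⟩
    rintro d (rfl | rfl) ⟨h2, h3⟩
    · linarith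
    · exact (digit_of_le h).symm

theorem iterate_digitMap_mem {q y : ℝ} (hq : q ∈ Ioo (1 : ℝ) 2) (hy : y ∈ Iq q)
    (hn : ∀ n, y ∉ switchSet q n) (n : ℕ) :
    (digitMap q)^[n] y ∈ Iq q ∧ (digitMap q)^[n] y ∉ Jq q := by
  suffices h : (digitMap q)^[n] y ∈ Iq q ∧ ∀ i, (digitMap q)^[n] y ∉ switchSet q i from
    ⟨h.1, h.2 0⟩
  induction n with
  | zero => exact ⟨hy, hn⟩
  | succ n ih =>
    rw [Function.iterate_succ_apply']
    exact ⟨(digitMap_mem_Iq hq ih.1 (ih.2 0)).1, fun i hi => ih.2 (i + 1) ⟨ih.2 0, hi⟩⟩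

theorem SigmaSet_eq_singleton {q y : ℝ} (hq : q ∈ Ioo (1 : ℝ) 2) (hy : y ∈ Iq q)
    (hn : ∀ n, y ∉ switchSet q n) :
    SigmaSet q y = {fun n => digit q ((digitMap q)^[n] y)} := by
  have hq0 : 0 < q := by linarith [hq.1]
  set w : ℕ → ℝ := fun n => (digitMap q)^[n] y with hw
  have hws : ∀ n, w (n + 1) = q * w n - digit q (w n) := fun n => by
    simp only [hw, Function.iterate_succ_apply', digitMap]
  have hwm := iterate_digitMap_mem hq hy hn
  have hdig : IsDigitSeq fun n => digit q (w n) := fun n => digit_eq _ _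
  ext a
  rw [mem_singleton_iff]
  constructor
  · rintro ⟨ha, hay⟩
    have key : ∀ n, piQ q (fun j => a (n + j)) = w n ∧ a n = digit q (w n) := by
      have step : ∀ n, piQ q (fun j => a (n + j)) = w n →
          a n = digit q (w n) ∧ piQ q (fun j => a (n + 1 + j)) = q * w n - a n := by
        intro n h
        have hs : IsDigitSeq fun j => a (n + 1 + j) := fun j => ha _
        have hc : consSeq (a n) (fun j => a (n + 1 + j)) = fun j => a (n + j) := by
          funext j
          cases j with
          | zero => rfl
          | succ j => simp only [consSeq]; congr 1; ring
        have h1 := hs.piQ_cons hq.1 (ha n)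
        rw [hc, h, eq_div_iff hq0.ne'] at h1
        have h2 : piQ q (fun j => a (n + 1 + j)) = q * w n - a n := by linarith
        exact ⟨(digitMap_mem_Iq hq (hwm n).1 (hwm n).2).2 _ (ha n)
          (h2 ▸ hs.piQ_mem_Iq hq.1), h2⟩
      intro n
      induction n with
      | zero =>
        have : piQ q (fun j => a (0 + j)) = w 0 := by
          simp only [zero_add]
          exact hay
        exact ⟨this, (step 0 this).1⟩
      | succ n ih =>
        have : piQ q (fun j => a (n + 1 + j)) = w (n + 1) := by
          rw [(step n ih.1).2, hws, ih.2]
        exact ⟨this, (step _ this).1⟩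
    funext n
    exact (key n).2
  · rintro rfl
    refine ⟨hdig, ?_⟩
    have hpart : ∀ n, ∑ j ∈ Finset.range n, digit q (w j) / q ^ (j + 1) = y - w n / q ^ n := by
      intro n
      induction n with
      | zero => simp [hw]
      | succ n ih =>
        rw [Finset.sum_range_succ, ih, hws]
        field_simp
        ring
    refine tendsto_nhds_unique (hdig.summable hq.1).hasSum.tendsto_sum_nat ?_
    simp only [hpart]
    have hlim : Filter.Tendsto (fun n => w n / q ^ n) Filter.atTop (nhds 0) := by
      have h2 : Filter.Tendsto (fun n => 1 / (q - 1) / q ^ n) Filter.atTop (nhds 0) :=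
        (tendsto_pow_atTop_atTop_of_one_lt hq.1).const_div_atTop _
      refine squeeze_zero (fun n => div_nonneg (hwm n).1.1 (by positivity)) (fun n => ?_) h2
      gcongr
      exact (hwm n).1.2
    simpa using hlim.const_sub y

theorem encard_SigmaSet_eq_one {q y : ℝ} (hq : q ∈ Ioo (1 : ℝ) 2) (hy : y ∈ Iq q)
    (hn : ∀ n, y ∉ switchSet q n) : (SigmaSet q y).encard = 1 := by
  rw [SigmaSet_eq_singleton hq hy hn, encard_singleton]

theorem le_sub_of_mem_switchSet {q y : ℝ} (hq : 1 < q) {n : ℕ} (hy : y ∈ switchSet q n) :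
    (q ^ (n + 1))⁻¹ ≤ 1 / (q - 1) - y := by
  have hq0 : 0 < q := by linarith
  have hcq : 1 / (q - 1) * (q - 1) = 1 := one_div_mul_cancel (by linarith)
  induction n generalizing y with
  | zero =>
    have h := hy.2
    rw [one_div_mul_sub_one, le_div_iff₀ hq0] at h
    rw [zero_add, pow_one, inv_le_iff_one_le_mul₀' hq0]
    linarith
  | succ n ih =>
    have h := ih hy.2
    have : digitMap q y ≥ q * y - 1 := by
      rw [digitMap]
      rcases digit_eq q y with h | h <;> linarith
    rw [pow_succ, mul_inv, ← div_eq_mul_inv, div_le_iff₀ hq0]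
    linarith

theorem switchSet_dichotomy {q d : ℝ} (hq : 1 < q) (hd : 1 / (q * (q - 1)) - 1 / q ≤ d) {n : ℕ}
    {y y' : ℝ} (hy : y ∈ switchSet q n) (hy' : y' ∈ switchSet q n) (hyy : y ≤ y') :
    y' - y ≤ d / q ^ n ∨ (q ^ (n + 1))⁻¹ ≤ y' - y := by
  have hq0 : 0 < q := by linarith
  have hcq : 1 / (q - 1) * (q - 1) = 1 := one_div_mul_cancel (by linarith)
  induction n generalizing y y' with
  | zero =>
    left
    rw [pow_zero, div_one]
    linarith [hy.1, hy'.2]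
  | succ n ih =>
    have same : digitMap q y' - digitMap q y = q * (y' - y) →
        y' - y ≤ d / q ^ (n + 1) ∨ (q ^ (n + 1 + 1))⁻¹ ≤ y' - y := by
      intro h
      rw [pow_succ q (n + 1), mul_inv, ← div_eq_mul_inv, div_le_iff₀ hq0, pow_succ, ← div_div,
        le_div_iff₀ hq0]
      rw [mul_comm, ← h]
      exact ih hy.2 hy'.2 (by nlinarith)
    rcases lt_or_ge y (1 / q) with h1 | h1
    · rcases lt_or_ge y' (1 / q) with h2 | h2
      · exact same (by rw [digitMap_of_lt h1, digitMap_of_lt h2]; ring)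
      · right
        have h3 := le_sub_of_mem_switchSet hq hy.2
        rw [digitMap_of_lt h1] at h3
        have h4 : 1 / (q - 1) < q * y' := by
          by_contra! h5
          exact hy'.1 ⟨h2, by rwa [one_div_mul_sub_one, le_div_iff₀' hq0]⟩
        rw [pow_succ, mul_inv, ← div_eq_mul_inv, div_le_iff₀ hq0]
        linarith
    · exact same (by rw [digitMap_of_le h1, digitMap_of_le (h1.trans hyy)]; ring)

theorem isClustered_switchSet {q e : ℝ} (hq : q ∈ Ioo (1 : ℝ) 2) {k : ℕ}
    (hd : 1 / (q * (q - 1)) - 1 / q ≤ (q ^ k)⁻¹) (j : ℕ) :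
    IsClustered (q ^ (k + j))⁻¹ ((q ^ j)⁻¹ / 2) {z | z + e ∈ switchSet q j} := by
  have hq0 : 0 < q := by linarith [hq.1]
  have h2 : (q ^ j)⁻¹ / 2 ≤ (q ^ (j + 1))⁻¹ := by
    rw [pow_succ, mul_inv, div_eq_mul_inv]
    gcongr
    exact hq.2.le
  have key : ∀ x y : ℝ, x + e ∈ switchSet q j → y + e ∈ switchSet q j → x ≤ y →
      |x - y| ≤ (q ^ (k + j))⁻¹ ∨ (q ^ j)⁻¹ / 2 ≤ |x - y| := by
    intro x y hx hy hxy
    rw [abs_sub_comm, abs_of_nonneg (sub_nonneg.2 hxy), pow_add, mul_inv, ← div_eq_mul_inv]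
    rcases switchSet_dichotomy hq.1 hd hx hy (by linarith) with h | h
    · left; linarith
    · right; linarith
  intro x hx y hy
  rcases le_total x y with h | h
  · exact key x y hx hy h
  · rw [abs_sub_comm]
    exact key y x hy hx h

theorem encard_SigmaSet_of_recurrence {q : ℝ} {k n : ℕ} {u : ℕ → ℝ} (hq : 1 < q)
    (hq1 : 1 / (q - 1) - 1 / q < 1) (hk : 1 ≤ k) (hu0 : 1 / (q - 1) < u 0 + 1)
    (hu : ∀ t, u (t + 1) = u t / q ^ k + (2 - q - (q ^ k)⁻¹) / (q - 1))
    (hU : ∀ t ≤ n, (SigmaSet q (u t)).encard = 1) {t : ℕ} (ht : t ≤ n) :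
    (SigmaSet q ((u t + 1) / q)).encard = t + 1 := by
  have hq0 : 0 < q := by linarith
  induction t with
  | zero =>
    rw [encard_SigmaSet_div hq, add_sub_cancel_right, hU 0 ht,
      encard_SigmaSet_of_notMem hq fun h => hu0.not_ge h.2]
    simp
  | succ t ih =>
    replace ih := ih (by omega)
    have h1 : 0 ≤ u t :=
      (mem_Iq_of_encard_ne_zero hq (by rw [hU t (by omega)]; exact one_ne_zero)).1
    have h2 := (mem_Iq_of_encard_ne_zero hq (by rw [ih]; simp)).2
    have h3 : 1 / q ≤ (u t + 1) / q := by gcongr; linarith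
    have h4 : 1 / (q - 1) - (1 / (q - 1) - (u t + 1) / q) / q ^ (k - 1) = u (t + 1) + 1 := by
      obtain ⟨k, rfl⟩ : ∃ j, k = j + 1 := ⟨k - 1, by omega⟩
      have hq1' : q - 1 ≠ 0 := by linarith
      rw [hu, Nat.add_sub_cancel]
      field_simp
      ring
    rw [encard_SigmaSet_div hq, add_sub_cancel_right, hU _ ht, ← h4,
      encard_SigmaSet_sub_div_pow hq (by linarith) (by linarith), ih, add_comm]
    push_cast
    ring

/-- The offsets which turn the recurrence of `encard_SigmaSet_of_recurrence` into a rescaling. -/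
noncomputable def offset (q : ℝ) (k t : ℕ) : ℝ :=
  (2 - q - (q ^ k)⁻¹) / (q - 1) * ∑ s ∈ Finset.range t, q ^ (k * (s + 1))

theorem le_dimH_UqM {q : ℝ} {k m : ℕ} (hq : q ∈ Ioo (19 / 10 : ℝ) 2) (hk : 4 ≤ k)
    (hkm : 16384 * (k * (m + 2 : ℕ) : ℝ) ≤ q ^ k)
    (hd : 1 / (q * (q - 1)) - 1 / q ≤ (q ^ k)⁻¹) (he : ∀ t < m + 2, |offset q k t| ≤ 1 / 16) :
    ENNReal.ofReal (1 - 4096 * (m + 2 : ℕ) / q ^ k) ≤ dimH (UqM q ((m : ℕ∞) + 2)) := by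
  obtain ⟨hq1, hq2⟩ := hq
  have hq0 : 0 < q := by linarith
  have hqm : q ∈ Ioo (1 : ℝ) 2 := ⟨by linarith, hq2⟩
  have hc1 : 1 < 1 / (q - 1) := by rw [lt_div_iff₀] <;> linarith
  have hc2 : 1 / (q - 1) < 5 / 4 := by rw [div_lt_iff₀] <;> linarith
  have hc3 : 1 / 2 < 1 / q := by gcongr
  refine (le_dimH_avoid (a₀ := 5 / 8) (M := m + 2)
    (A := fun t j => {z | z + offset q k t ∈ switchSet q j}) (by linarith) hk (by omega) hkm
    fun t ht j => isClustered_switchSet hqm hd j).trans ?_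
  set E := {x | x ∈ Icc (5 / 8 : ℝ) (5 / 8 + 1 / 4) ∧
    ∀ t < m + 2, ∀ j, x ∉ {z | z + offset q k t ∈ switchSet q j}} with hE
  set f : ℝ → ℝ := fun z => ((z + offset q k (m + 1)) / q ^ (k * (m + 1)) + 1) / q with hf
  have hanti : AntilipschitzWith (Real.toNNReal (q ^ (k * (m + 1)) * q)) f := by
    refine AntilipschitzWith.of_le_mul_dist fun x y => ?_
    rw [Real.coe_toNNReal _ (by positivity), Real.dist_eq, Real.dist_eq]
    have : f x - f y = (x - y) / (q ^ (k * (m + 1)) * q) := by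
      simp only [hf]
      field_simp
      ring
    rw [this, abs_div, abs_of_pos (a := q ^ (k * (m + 1)) * q) (by positivity),
      mul_div_cancel₀ _ (by positivity)]
  refine (hanti.le_dimH_image E).trans (dimH_mono ?_)
  rintro _ ⟨z, ⟨hz, hzA⟩, rfl⟩
  set u : ℕ → ℝ := fun t => (z + offset q k t) / q ^ (k * t) with hu
  have hU : ∀ t ≤ m + 1, (SigmaSet q (u t)).encard = 1 := by
    intro t ht
    have h := abs_le.1 (he t (by omega))
    have h1 : 0 ≤ z + offset q k t := by linarith [hz.1]
    have h2 : z + offset q k t < 1 := by linarith [hz.2]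
    simp only [hu]
    rw [encard_SigmaSet_div_pow hqm.1 h1 h2]
    exact encard_SigmaSet_eq_one hqm ⟨h1, by linarith⟩ (hzA t (by omega))
  have key : (SigmaSet q (f z)).encard = (m + 1 : ℕ) + 1 := by
    refine encard_SigmaSet_of_recurrence (k := k) (u := u) hqm.1 (by linarith) (by omega) ?_ ?_ hU le_rfl
    · simp only [hu, offset]
      simp
      norm_num at hc2 hz
      linarith [hz.1]
    · intro t
      simp only [hu, offset, Finset.sum_range_succ, mul_add, pow_add, mul_one]
      have : q - 1 ≠ 0 := by linarith
      field_simp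
      ring
  refine ⟨mem_Iq_of_encard_ne_zero hqm.1 (by rw [key]; simp), ?_⟩
  rw [key]
  push_cast
  rw [add_assoc]
  norm_num

theorem IsBonacci.pow_mul_two_sub {k : ℕ} {p : ℝ} (hp : IsBonacci k p) : p ^ k * (2 - p) = 1 := by
  have h := geom_sum_mul p k
  rw [← hp.2] at h
  linarith

theorem IsBonacci.lt {k : ℕ} {p : ℝ} (hp : IsBonacci k p) (hk : 30 ≤ k) : 1.9999 < p := by
  obtain ⟨⟨hp1, hp2⟩, hsum⟩ := id hp
  have hp0 : 0 < p := by linarith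
  have h1 : p ^ (k - 2) * (p + 1) ≤ p ^ k := by
    rw [hsum]
    obtain ⟨k, rfl⟩ : ∃ j, k = j + 2 := ⟨k - 2, by omega⟩
    rw [Finset.sum_range_succ, Finset.sum_range_succ, Nat.add_sub_cancel, mul_add, mul_one,
      ← pow_succ]
    have : 0 ≤ ∑ i ∈ Finset.range k, p ^ i := by positivity
    linarith
  have h2 : p + 1 ≤ p ^ 2 := by
    rw [← Nat.sub_add_cancel (show 2 ≤ k by omega), pow_add, Nat.sub_add_cancel (by omega)] at h1
    exact le_of_mul_le_mul_left h1 (by positivity)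
  have h3 : 1.6 ≤ p := by
    by_contra! h
    nlinarith
  have h4 : (10 : ℝ) ^ 6 ≤ p ^ k := calc
    (10 : ℝ) ^ 6 ≤ 1.6 ^ 30 := by norm_num
    _ ≤ p ^ 30 := by gcongr
    _ ≤ p ^ k := pow_le_pow_right₀ hp1.le hk
  have h5 := hp.pow_mul_two_sub
  nlinarith

theorem two_pow_le_of_pow_mul_two_sub {k n : ℕ} {p : ℝ} (hp0 : 0 < p) (hp2 : p < 2)
    (hp : p ^ k * (2 - p) = 1) (hn : 16384 * (n : ℝ) ≤ p ^ k) : (2 : ℝ) ^ n ≤ 1.01 * p ^ n := by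
  have h := one_add_mul_le_pow (a := p / 2 - 1) (by linarith) n
  have h1 : (n : ℝ) * (2 - p) ≤ 1 / 16384 := by nlinarith
  rw [add_sub_cancel, div_pow, le_div_iff₀ (by positivity)] at h
  have h2 : (0 : ℝ) < 2 ^ n := by positivity
  nlinarith

theorem pow_le_pow_of_log_le {k M : ℕ} (hM : 1 ≤ M)
    (h : 20 / 19 * (Real.log M / Real.log 1.999 + 24) + 4 ≤ (k : ℝ)) :
    ((M : ℝ) * 1.999 ^ 24) ^ 20 ≤ (1.999 ^ (k - 4)) ^ 19 := by
  have hM0 : (0 : ℝ) < M := by exact_mod_cast hM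
  have hr : 0 < Real.log 1.999 := Real.log_pos (by norm_num)
  have hM1 : 0 ≤ Real.log M := Real.log_nonneg (by exact_mod_cast hM)
  have hk : 4 ≤ k := by
    have : (4 : ℝ) ≤ k := by
      have : 0 ≤ Real.log M / Real.log 1.999 := by positivity
      linarith
    exact_mod_cast this
  rw [← Real.log_le_log_iff (by positivity) (by positivity), Real.log_pow,
    Real.log_mul (by positivity) (by positivity), Real.log_pow, Real.log_pow, Real.log_pow,
    Nat.cast_sub hk]
  have h1 : Real.log M / Real.log 1.999 * Real.log 1.999 = Real.log M :=
    div_mul_cancel₀ _ hr.ne'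
  have h2 := mul_le_mul_of_nonneg_right h hr.le
  push_cast
  nlinarith

theorem rpow_mul_lt_pow {k M : ℕ} (hM : 1 ≤ M)
    (h : ((M : ℝ) * 1.999 ^ 24) ^ 20 ≤ (1.999 ^ (k - 4)) ^ 19) :
    1024 * (M : ℝ) ^ ((20 : ℝ) / 19) < 1.999 ^ (k - 4) := by
  have hM0 : (0 : ℝ) < M := by exact_mod_cast hM
  have h1 : ((M : ℝ) * 1.999 ^ 24) ^ ((20 : ℝ) / 19) ≤ 1.999 ^ (k - 4) := by
    have h2 := Real.rpow_le_rpow (by positivity) h (show (0 : ℝ) ≤ ((19 : ℕ) : ℝ)⁻¹ by positivity)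
    rwa [Real.pow_rpow_inv_natCast (by positivity) (by norm_num), ← Real.rpow_natCast,
      ← Real.rpow_mul (by positivity), Nat.cast_ofNat, Nat.cast_ofNat, ← div_eq_mul_inv] at h2
  refine lt_of_lt_of_le ?_ h1
  rw [Real.mul_rpow (by positivity) (by positivity), mul_comm]
  gcongr
  calc (1024 : ℝ) < 1.999 ^ 24 := by norm_num
    _ ≤ (1.999 ^ 24) ^ ((20 : ℝ) / 19) := Real.self_le_rpow_of_one_le (by norm_num) (by norm_num)

theorem mul_le_pow_of_pow_le {k M : ℕ} (hk : 4 ≤ k)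
    (h : ((M : ℝ) * 1.999 ^ 24) ^ 20 ≤ (1.999 ^ (k - 4)) ^ 19) :
    16384 * (k * M : ℝ) ≤ 1.999 ^ k := by
  have hk1 : (k : ℝ) ≤ 40 * 1.03 ^ k := by
    have := one_add_mul_le_pow (a := (0.03 : ℝ)) (by norm_num) k
    norm_num at this ⊢
    linarith
  have hk2 : (k : ℝ) ^ 20 ≤ 40 ^ 20 * 1.999 ^ k := calc
    (k : ℝ) ^ 20 ≤ (40 * 1.03 ^ k) ^ 20 := by gcongr
    _ = 40 ^ 20 * (1.03 ^ 20) ^ k := by rw [mul_pow, ← pow_mul, ← pow_mul, mul_comm k]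
    _ ≤ 40 ^ 20 * 1.999 ^ k := by gcongr; norm_num
  rw [← pow_le_pow_iff_left₀ (by positivity) (by positivity) (show 20 ≠ 0 by norm_num)]
  refine le_of_mul_le_mul_right ?_
    (show (0 : ℝ) < (1.999 ^ 24) ^ 20 * (1.999 ^ 4) ^ 19 by positivity)
  calc (16384 * (k * M : ℝ)) ^ 20 * ((1.999 ^ 24) ^ 20 * (1.999 ^ 4) ^ 19)
      = 16384 ^ 20 * (k : ℝ) ^ 20 * ((M : ℝ) * 1.999 ^ 24) ^ 20 * (1.999 ^ 4) ^ 19 := by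
        rw [mul_pow, mul_pow, mul_pow]; ring
    _ ≤ 16384 ^ 20 * (40 ^ 20 * 1.999 ^ k) * (1.999 ^ (k - 4)) ^ 19 * (1.999 ^ 4) ^ 19 := by
        gcongr
    _ = 16384 ^ 20 * 40 ^ 20 * (1.999 ^ k) ^ 20 := by
        rw [mul_assoc _ ((1.999 ^ (k - 4)) ^ 19), ← mul_pow, ← pow_add, Nat.sub_add_cancel hk]
        generalize (1.999 : ℝ) ^ k = x
        ring
    _ ≤ (1.999 ^ k) ^ 20 * ((1.999 ^ 24) ^ 20 * (1.999 ^ 4) ^ 19) := by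
        rw [mul_comm]
        exact mul_le_mul_of_nonneg_left (by norm_num) (by positivity)

theorem abs_two_sub_le {p q : ℝ} {k : ℕ} (hp : 1 < p) (hp2 : p < 2) (hq : 1 < q) (hq2 : q < 2)
    (hpk : p ^ k * (2 - p) = 1) (hk : 16384 * (k : ℝ) ≤ p ^ k) (hkq : 16384 * (k : ℝ) ≤ q ^ k) :
    |2 - q - (q ^ k)⁻¹| ≤ 2 * |q - p| := by
  have hp0 : 0 < p := by linarith
  have hq0 : 0 < q := by linarith
  have h1 : |q ^ k - p ^ k| ≤ |q - p| * (k * (1.01 * p ^ k)) := calc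
    |q ^ k - p ^ k| ≤ |q - p| * k * max |q| |p| ^ (k - 1) := abs_pow_sub_pow_le ..
    _ ≤ |q - p| * k * 2 ^ (k - 1) := by
      gcongr
      rw [abs_of_pos hq0, abs_of_pos hp0]
      exact max_le hq2.le hp2.le
    _ ≤ |q - p| * k * 2 ^ k := by
      gcongr
      · norm_num
      · omega
    _ ≤ |q - p| * (k * (1.01 * p ^ k)) := by
      rw [mul_assoc]
      gcongr
      exact two_pow_le_of_pow_mul_two_sub hp0 hp2 hpk hk
  have h2 : 2 - q - (q ^ k)⁻¹ = (p - q) + (q ^ k - p ^ k) / (p ^ k * q ^ k) := by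
    have : 2 - p = (p ^ k)⁻¹ := eq_inv_of_mul_eq_one_right hpk
    rw [sub_div, div_mul_cancel_right₀ (by positivity), div_mul_cancel_left₀ (by positivity)]
    linarith
  have h3 : |(q ^ k - p ^ k) / (p ^ k * q ^ k)| ≤ |q - p| := by
    rw [abs_div, abs_of_pos (a := p ^ k * q ^ k) (by positivity), div_le_iff₀ (by positivity)]
    refine h1.trans ?_
    have : (k : ℝ) * (1.01 * p ^ k) ≤ p ^ k * q ^ k := by
      have : 0 < p ^ k := by positivity
      have : (k : ℝ) * 1.01 ≤ q ^ k := by linarith [(Nat.cast_nonneg k : (0 : ℝ) ≤ k)]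
      nlinarith
    gcongr
  rw [h2]
  refine (abs_add_le _ _).trans ?_
  rw [abs_sub_comm p q]
  linarith

theorem abs_offset_le {p q : ℝ} {k M t : ℕ} (hp : 1 < p) (hp2 : p < 2) (hq : 1.9 < q)
    (hq2 : q < 2) (hk : 0 < k) (hM : 0 < M) (hpk : p ^ k * (2 - p) = 1)
    (hkp : 16384 * (k * M : ℝ) ≤ p ^ k) (hkq : 16384 * (k * M : ℝ) ≤ q ^ k)
    (hpq : |q - p| ≤ 1 / p ^ (M * k)) (ht : t < M) : |offset q k t| ≤ 1 / 16 := by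
  have hp0 : 0 < p := by linarith
  have hq0 : 0 < q := by linarith
  have hk1 : (1 : ℝ) ≤ k := by exact_mod_cast hk
  have hM1 : (1 : ℝ) ≤ M := by exact_mod_cast hM
  have hkM : (k : ℝ) ≤ k * M := by nlinarith
  have hκ := abs_two_sub_le hp hp2 (by linarith) hq2 hpk (by linarith) (by linarith)
  have h2 : (2 : ℝ) ^ (M * k) ≤ 1.01 * p ^ (M * k) :=
    two_pow_le_of_pow_mul_two_sub hp0 hp2 hpk (by push_cast; linarith)
  have hsum : ∑ s ∈ Finset.range t, q ^ (k * (s + 1)) ≤ M * (q ^ (M * k) / q ^ k) := by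
    have hterm : ∀ s ∈ Finset.range t, q ^ (k * (s + 1)) ≤ q ^ (M * k) / q ^ k := by
      intro s hs
      rw [le_div_iff₀ (by positivity), ← pow_add]
      refine pow_le_pow_right₀ (by linarith) ?_
      have := Finset.mem_range.1 hs
      nlinarith
    refine (Finset.sum_le_card_nsmul _ _ _ hterm).trans ?_
    rw [Finset.card_range, nsmul_eq_mul]
    gcongr
  have hsum0 : 0 ≤ ∑ s ∈ Finset.range t, q ^ (k * (s + 1)) := by positivity
  rw [offset, abs_mul, abs_div, abs_of_nonneg hsum0, abs_of_pos (a := q - 1) (by linarith)]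
  have hκ' : |2 - q - (q ^ k)⁻¹| / (q - 1) ≤ 3 / p ^ (M * k) := by
    rw [div_le_iff₀ (by linarith)]
    have : (0 : ℝ) < 1 / p ^ (M * k) := by positivity
    rw [← one_div_mul_eq_div, mul_comm]
    have : 2 * |q - p| ≤ 2 * (1 / p ^ (M * k)) := by linarith
    nlinarith
  calc |2 - q - (q ^ k)⁻¹| / (q - 1) * ∑ s ∈ Finset.range t, q ^ (k * (s + 1))
      ≤ 3 / p ^ (M * k) * (M * (q ^ (M * k) / q ^ k)) := by gcongr
    _ ≤ 3 / p ^ (M * k) * (M * (1.01 * p ^ (M * k) / q ^ k)) := by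
      gcongr
      exact (pow_le_pow_left₀ hq0.le hq2.le _).trans h2
    _ = 3.03 * M / q ^ k := by
      field_simp
      norm_num
    _ ≤ 1 / 16 := by
      rw [div_le_iff₀ (by positivity)]
      nlinarith

theorem switchRegion_length_le {p q : ℝ} {k : ℕ} (hp : 1 < p) (hp2 : p < 2) (hq : 1.9 < q)
    (hq2 : q < 2) (hpk : p ^ k * (2 - p) = 1) (hk : 16384 * (k : ℝ) ≤ p ^ k)
    (hpq : |q - p| ≤ 1 / (4 * p ^ k)) : 1 / (q * (q - 1)) - 1 / q ≤ (q ^ k)⁻¹ := by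
  have hp0 : 0 < p := by linarith
  have hq0 : 0 < q := by linarith
  have hq1 : 0 < q - 1 := by linarith
  have h1 : q ^ k ≤ 1.01 * p ^ k :=
    (pow_le_pow_left₀ hq0.le hq2.le k).trans (two_pow_le_of_pow_mul_two_sub hp0 hp2 hpk hk)
  have h2 : 2 - q ≤ 1.25 / p ^ k := by
    have h3 : 2 - p = (p ^ k)⁻¹ := eq_inv_of_mul_eq_one_right hpk
    have h4 := (abs_le.1 hpq).1
    have h5 : (1.25 : ℝ) / p ^ k = (p ^ k)⁻¹ + 1 / (4 * p ^ k) := by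
      field_simp
      norm_num
    linarith
  have h3 : 1 / (q * (q - 1)) - 1 / q = (2 - q) / (q * (q - 1)) := by
    field_simp
    ring
  rw [h3, div_le_iff₀ (by positivity), inv_mul_eq_div, le_div_iff₀ (by positivity)]
  calc (2 - q) * q ^ k ≤ 1.25 / p ^ k * (1.01 * p ^ k) := by gcongr
    _ = 1.2625 := by
      field_simp
      norm_num
    _ ≤ q * (q - 1) := by nlinarith

theorem bonacci_neighbourhoods_in_B
    (m : ℕ) (hm : 1 ≤ m) (k : ℕ) (qk : ℝ) (hqk : IsBonacci k qk)
    (hk : (⌈(20 / 19 : ℝ) * (Real.log ((m : ℝ) + 2) / Real.log 1.999 + 24) + 4⌉ : ℤ) ≤ (k : ℤ))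
    (q : ℝ) (hq : q ∈ Set.Ioo (1 : ℝ) 2)
    (hclose : |q - qk| < qk ^ (-(((m : ℤ) + 2) * (k : ℤ)) - 3)) :
    q ∈ Bset ((m : ℕ∞) + 2) ∧
      ENNReal.ofReal (1 - 1024 * ((m : ℝ) + 2) ^ ((20 : ℝ) / 19) * q ^ (4 - (k : ℤ))) ≤
        dimH (UqM q ((m : ℕ∞) + 2)) ∧
      0 < 1 - 1024 * ((m : ℝ) + 2) ^ ((20 : ℝ) / 19) * q ^ (4 - (k : ℤ)) := by
  have hlog : 20 / 19 * (Real.log ((m + 2 : ℕ) : ℝ) / Real.log 1.999 + 24) + 4 ≤ (k : ℝ) := by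
    have := Int.ceil_le.1 hk
    push_cast at this ⊢
    exact this
  have hM : 1 ≤ m + 2 := by omega
  have hk30 : 30 ≤ k := by
    have h1 : 0 ≤ Real.log ((m + 2 : ℕ) : ℝ) / Real.log 1.999 :=
      div_nonneg (Real.log_nonneg (by exact_mod_cast hM)) (Real.log_nonneg (by norm_num))
    have : (29 : ℝ) < k := by linarith
    exact_mod_cast this
  have hpow := pow_le_pow_of_log_le hM hlog
  have hp := hqk.lt hk30
  have hp2 := hqk.1.2
  have hp0 : 0 < qk := by linarith
  have hpk := hqk.pow_mul_two_sub
  have hpk0 : 0 < qk ^ k := by positivity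
  have hclose' : |q - qk| ≤ 1 / (4 * qk ^ ((m + 2) * k)) := by
    refine hclose.le.trans ?_
    have h1 : -(((m : ℤ) + 2) * (k : ℤ)) - 3 = -(((m + 2) * k + 3 : ℕ) : ℤ) := by
      push_cast
      ring
    rw [h1, zpow_neg, zpow_natCast, ← one_div, pow_add, mul_comm]
    gcongr
    calc (4 : ℝ) ≤ 1.9 ^ 3 := by norm_num
      _ ≤ qk ^ 3 := by gcongr; linarith
  have hbig := mul_le_pow_of_pow_le (by omega) hpow
  have hkp : 16384 * (k * (m + 2 : ℕ) : ℝ) ≤ qk ^ k :=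
    hbig.trans (pow_le_pow_left₀ (by norm_num) (by linarith) k)
  have hkk : 16384 * (k : ℝ) ≤ qk ^ k := by
    push_cast at hkp
    have : (0 : ℝ) ≤ k * m := by positivity
    have : (0 : ℝ) ≤ k := by positivity
    linarith
  have hclose₁ : |q - qk| ≤ 1 / (4 * qk ^ k) := by
    refine hclose'.trans ?_
    gcongr
    · linarith
    · exact Nat.le_mul_of_pos_left _ (by omega)
  have hq1 : 1.999 < q := by
    have h30 : (30 : ℝ) ≤ k := by exact_mod_cast hk30
    have h1 : 1 / (4 * qk ^ k) ≤ 0.0001 := by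
      rw [div_le_iff₀ (by positivity)]
      linarith
    linarith [(abs_le.1 hclose₁).1]
  have hkq := hbig.trans (pow_le_pow_left₀ (by norm_num) hq1.le k)
  have hdim := le_dimH_UqM (m := m) ⟨by linarith, hq.2⟩ (by omega) hkq
    (switchRegion_length_le (by linarith) hp2 (by linarith) hq.2 hpk hkk hclose₁)
    fun t ht => abs_offset_le (by linarith) hp2 (by linarith) hq.2 (by omega) (by omega) hpk hkp hkq
      (hclose'.trans (by gcongr; linarith [pow_pos hp0 ((m + 2) * k)])) ht
  have hq0 : 0 < q := by linarith [hq.1]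
  have hzpow : q ^ (4 - (k : ℤ)) = 1 / q ^ (k - 4) := by
    rw [one_div, ← zpow_natCast, ← zpow_neg, Nat.cast_sub (by omega)]
    congr 1
    push_cast
    ring
  have hpos : 0 < 1 - 1024 * ((m : ℝ) + 2) ^ ((20 : ℝ) / 19) * q ^ (4 - (k : ℤ)) := by
    have h1 := rpow_mul_lt_pow hM hpow
    have h2 : (1.999 : ℝ) ^ (k - 4) ≤ q ^ (k - 4) := by gcongr
    rw [hzpow, sub_pos, mul_one_div, div_lt_one (by positivity)]
    push_cast at h1
    linarith
  have hle : ENNReal.ofReal (1 - 1024 * ((m : ℝ) + 2) ^ ((20 : ℝ) / 19) * q ^ (4 - (k : ℤ))) ≤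
      dimH (UqM q ((m : ℕ∞) + 2)) := by
    refine (ENNReal.ofReal_le_ofReal ?_).trans hdim
    have h1 : (m : ℝ) + 2 ≤ ((m : ℝ) + 2) ^ ((20 : ℝ) / 19) :=
      Real.self_le_rpow_of_one_le (by linarith [(Nat.cast_nonneg m : (0 : ℝ) ≤ m)]) (by norm_num)
    have h2 : (4 : ℝ) ≤ q ^ 4 := by
      have : (1.9 : ℝ) ^ 4 ≤ q ^ 4 := by gcongr; linarith
      linarith
    have h3 : q ^ k = q ^ 4 * q ^ (k - 4) := by rw [← pow_add]; congr 1; omega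
    rw [hzpow, mul_one_div, h3]
    push_cast
    rw [← div_div]
    gcongr
    rw [div_le_iff₀ (by positivity)]
    nlinarith
  refine ⟨⟨hq, ?_⟩, hle, hpos⟩
  rw [nonempty_iff_ne_empty]
  intro h
  rw [h, dimH_empty] at hle
  exact (ENNReal.ofReal_pos.2 hpos).not_ge hle
end

section
/- Let m ≥ 1 and k ≥ 4 be integers. If q ∈ (1,2) satisfies |q − q_k| < q_k^{−(m+1)k−3}, then there exists a sequence (c_j) ∈ {0,1}^ℕ with π_q((c_j)) = 1 whose first mk digits are (1^{k−1}0)^m, i.e. c_1⋯c_{mk} consists of m consecutive copies of the block of k−1 ones followed by a zero. -/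
open Set

open Finset in
/-- If the orbit `x (n + 1) = q * x n - c n` of digits stays eventually in `Iq q`, then the digits
expand the starting point. -/
theorem piQ_eq_of_orbit {q : ℝ} (hq : 1 < q) {c x : ℕ → ℝ} (hc : IsDigitSeq c)
    (hx : ∀ n, x (n + 1) = q * x n - c n) (N : ℕ) (hN : ∀ n ≥ N, x n ∈ Iq q) :
    piQ q c = x 0 := by
  have hq0 : 0 < q := by linarith
  have hpart : ∀ n, ∑ j ∈ range n, c j / q ^ (j + 1) = x 0 - x n / q ^ n := by
    intro n
    induction n with
    | zero => simp
    | succ n ih =>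
      rw [sum_range_succ, ih, hx n]
      field_simp
      ring
  have hlim : Filter.Tendsto (fun n => x n / q ^ n) Filter.atTop (nhds 0) := by
    have hgeom : Filter.Tendsto (fun n : ℕ => 1 / (q - 1) * (1 / q) ^ n) Filter.atTop
        (nhds 0) := by
      simpa using (tendsto_pow_atTop_nhds_zero_of_lt_one (r := 1 / q) (by positivity)
        ((div_lt_one hq0).2 hq)).const_mul (1 / (q - 1))
    refine tendsto_of_tendsto_of_tendsto_of_le_of_le' tendsto_const_nhds hgeom ?_ ?_
    · filter_upwards [Filter.eventually_ge_atTop N] with n hn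
      exact div_nonneg (hN n hn).1 (by positivity)
    · filter_upwards [Filter.eventually_ge_atTop N] with n hn
      rw [one_div_pow, div_eq_mul_one_div (x n)]
      exact mul_le_mul_of_nonneg_right (hN n hn).2 (by positivity)
  refine HasSum.tsum_eq ((hasSum_iff_tendsto_nat_of_nonneg ?_ _).2 ?_)
  · intro j
    rcases hc j with h | h <;> rw [h] <;> positivity
  · simp only [hpart]
    simpa using hlim.const_sub (x 0)

/-- The digit used at time `j`: prescribed by `w` before time `N`, greedy afterwards. -/
noncomputable def prefixGreedyDigit (q : ℝ) (w : ℕ → ℝ) (N j : ℕ) (y : ℝ) : ℝ :=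
  if j < N then w j else if 1 ≤ q * y then 1 else 0

/-- The orbit of `y` under the digits `prefixGreedyDigit`. -/
noncomputable def prefixGreedyOrbit (q : ℝ) (w : ℕ → ℝ) (N : ℕ) (y : ℝ) : ℕ → ℝ
  | 0 => y
  | j + 1 => q * prefixGreedyOrbit q w N y j -
      prefixGreedyDigit q w N j (prefixGreedyOrbit q w N y j)

/-- A prescribed prefix extends to an expansion of `x 0` as soon as its orbit `x` ends in `Iq q`. -/
theorem exists_expansion_of_prefix_orbit {q : ℝ} (hq : q ∈ Ioo (1 : ℝ) 2) {w x : ℕ → ℝ}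
    (hw : IsDigitSeq w) (hx : ∀ n, x (n + 1) = q * x n - w n) (N : ℕ) (hN : x N ∈ Iq q) :
    ∃ c, IsDigitSeq c ∧ piQ q c = x 0 ∧ ∀ j < N, c j = w j := by
  obtain ⟨hq1, hq2⟩ := hq
  set y := prefixGreedyOrbit q w N (x 0)
  have hys : ∀ j, y (j + 1) = q * y j - prefixGreedyDigit q w N j (y j) := fun j => rfl
  have hdig : IsDigitSeq fun j => prefixGreedyDigit q w N j (y j) := by
    intro j
    have := hw j
    simp only [prefixGreedyDigit]
    split_ifs <;> simp [this]
  have heq : ∀ n ≤ N, y n = x n := by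
    intro n
    induction n with
    | zero => intro _; rfl
    | succ n ih =>
      intro hn
      rw [hys, ih (by omega), hx, prefixGreedyDigit, if_pos (by omega)]
  have hmem : ∀ n ≥ N, y n ∈ Iq q := by
    intro n hn
    induction n, hn using Nat.le_induction with
    | base => rwa [heq N le_rfl]
    | succ n hn ih =>
      obtain ⟨h0, h1⟩ := ih
      have hpos : 0 < q - 1 := by linarith
      rw [le_div_iff₀ hpos] at h1
      rw [hys, prefixGreedyDigit, if_neg (by omega)]
      split_ifs with h
      · exact ⟨by linarith, (le_div_iff₀ hpos).2 (by nlinarith)⟩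
      · exact ⟨by nlinarith, (le_div_iff₀ hpos).2 (by nlinarith)⟩
  refine ⟨_, hdig, piQ_eq_of_orbit (x := y) hq1 hdig hys N hmem, fun j hj => ?_⟩
  simp [prefixGreedyDigit, hj]

/-- The orbit of `y` under a prescribed digit sequence. -/
noncomputable def digitOrbit (q : ℝ) (w : ℕ → ℝ) (y : ℝ) : ℕ → ℝ
  | 0 => y
  | j + 1 => q * digitOrbit q w y j - w j

theorem isDigitSeq_seqP (k : ℕ) : IsDigitSeq (seqP k) := by
  intro j
  simp only [seqP]
  split_ifs <;> simp

open Finset in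
theorem digitOrbit_seqP_mul (q : ℝ) {k : ℕ} (hk : 1 ≤ k) (i : ℕ) :
    digitOrbit q (seqP k) 1 (i * k) =
      1 + (∑ j ∈ range i, (q ^ k) ^ j) * (q ^ k - ∑ t ∈ range k, q ^ t) := by
  induction i with
  | zero => simp [digitOrbit]
  | succ i ih =>
    obtain ⟨l, rfl⟩ : ∃ l, k = l + 1 := ⟨k - 1, by omega⟩
    set z := digitOrbit q (seqP (l + 1)) 1 with hz
    have hzs : ∀ j, z (j + 1) = q * z j - seqP (l + 1) j := fun j => rfl
    have hones : ∀ j ≤ l, z (i * (l + 1) + j) =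
        q ^ j * z (i * (l + 1)) - ∑ t ∈ range j, q ^ t := by
      intro j
      induction j with
      | zero => simp
      | succ j ihj =>
        intro hj
        have hone : seqP (l + 1) (i * (l + 1) + j) = 1 := by
          rw [seqP, if_neg]
          rw [Nat.mul_add_mod', Nat.mod_eq_of_lt (by omega)]
          omega
        rw [← add_assoc, hzs, ihj (by omega), hone, geom_sum_succ]
        ring
    have hzero : seqP (l + 1) (i * (l + 1) + l) = 0 := by
      rw [seqP, if_pos]
      rw [Nat.mul_add_mod', Nat.mod_eq_of_lt (by omega)]
      omega
    have hstep : z ((i + 1) * (l + 1)) = q * z (i * (l + 1) + l) := by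
      rw [show (i + 1) * (l + 1) = i * (l + 1) + l + 1 by ring, hzs, hzero, sub_zero]
    rw [hstep, hones l le_rfl, ih, geom_sum_succ (n := i), geom_sum_succ (n := l)]
    ring

theorem IsBonacci.two_sub_mul_pow {k : ℕ} {p : ℝ} (hp : IsBonacci k p) :
    (2 - p) * p ^ k = 1 := by
  have := mul_geom_sum p k
  rw [← hp.2] at this
  linarith

open Finset in
theorem IsBonacci.lower_bound {k : ℕ} {p : ℝ} (hk : 4 ≤ k) (hp : IsBonacci k p) :
    19 / 10 < p := by
  obtain ⟨⟨h1, h2⟩, hs⟩ := hp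
  obtain ⟨l, rfl⟩ : ∃ l, k = l + 4 := ⟨k - 4, by omega⟩
  have hl : 0 < p ^ l := by positivity
  have hnn : 0 ≤ ∑ i ∈ range l, p ^ i := sum_nonneg fun i _ => by positivity
  simp only [sum_range_succ] at hs
  have hquart : 1 + p + p ^ 2 + p ^ 3 ≤ p ^ 4 := by
    refine le_of_mul_le_mul_left ?_ hl
    ring_nf at hs ⊢
    linarith
  by_contra! h
  nlinarith [mul_pos (sub_pos.2 h1) (sub_pos.2 h1), pow_pos (sub_pos.2 h1) 3,
    mul_nonneg (pow_pos (sub_pos.2 h1) 2).le (sub_nonneg.2 h),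
    mul_nonneg (pow_pos (sub_pos.2 h1) 3).le (sub_nonneg.2 h),
    mul_nonneg (sub_pos.2 h1).le (sub_nonneg.2 h)]

/-- If `n * (M - p) ≤ 1 / 2` then the `n`-th powers of `p` and `M` differ at most by a
factor two. -/
theorem pow_le_two_mul_pow {p M : ℝ} {n : ℕ} (hp : 1 ≤ p) (hpM : p ≤ M)
    (h : n * (M - p) ≤ 1 / 2) : M ^ n ≤ 2 * p ^ n := by
  have hM : 0 < M := by linarith
  have hbern := one_add_mul_le_pow (a := p / M - 1)
    (by have : 0 ≤ p / M := by positivity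
        linarith) n
  rw [show 1 + (p / M - 1) = p / M by ring, div_pow, le_div_iff₀ (by positivity)] at hbern
  have hsmall : (n : ℝ) * (1 - p / M) ≤ 1 / 2 := by
    have : 1 - p / M ≤ M - p := by
      rw [one_sub_div hM.ne', div_le_iff₀ hM]
      nlinarith
    exact (mul_le_mul_of_nonneg_left this n.cast_nonneg).trans h
  have : 0 < M ^ n := by positivity
  nlinarith

open Finset in
/-- For `q` close to the `k`-Bonacci number `p`, the displacement of `1` after `m` periods,
multiplied by `q - 1`, is at most `2 - q`. -/
theorem abs_geom_sum_mul_le {m k : ℕ} (hk : 4 ≤ k) {p q : ℝ} (hp : IsBonacci k p)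
    (hq : 1 < q) (hclose : |q - p| * (p ^ (m * k) * p ^ k * p ^ 3) < 1) :
    |(∑ j ∈ range m, (q ^ k) ^ j) * ((2 - q) * q ^ k - 1)| ≤ 2 - q ∧ 3 / 2 ≤ q := by
  have hp19 := hp.lower_bound hk
  have hp2 := hp.1.2
  have he := hp.two_sub_mul_pow
  set d := |q - p| with hd
  have hd0 : 0 ≤ d := abs_nonneg _
  set n := m * k with hn
  have hpn1 : 1 ≤ p ^ n := one_le_pow₀ (by linarith)
  have hbern : ∀ i : ℕ, 9 / 10 * (i : ℝ) ≤ p ^ i := fun i => by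
    have := one_add_mul_le_pow (a := p - 1) (by linarith) i
    rw [add_sub_cancel] at this
    nlinarith [(Nat.cast_nonneg i : (0 : ℝ) ≤ i)]
  have he0 : 0 < 2 - p := by linarith
  have hp3 : 34 / 5 ≤ p ^ 3 := by
    calc (34 / 5 : ℝ) ≤ (19 / 10) ^ 3 := by norm_num
      _ ≤ p ^ 3 := by gcongr
  have hdp : 34 / 5 * (d * p ^ n) ≤ 2 - p := by
    have h1 : d * p ^ n * p ^ 3 ≤ 2 - p := by
      have := mul_le_mul_of_nonneg_left hclose.le he0.le
      calc d * p ^ n * p ^ 3 = d * p ^ n * p ^ 3 * ((2 - p) * p ^ k) := by rw [he, mul_one]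
        _ = (2 - p) * (d * (p ^ n * p ^ k * p ^ 3)) := by ring
        _ ≤ 2 - p := by linarith
    have h2 : 0 ≤ d * p ^ n := by positivity
    nlinarith
  have hdle : d ≤ d * p ^ n := le_mul_of_one_le_right hd0 hpn1
  have hqd := abs_le.1 hd.ge
  have hq32 : 3 / 2 ≤ q := by linarith
  refine ⟨?_, hq32⟩
  set M := max p q with hM
  have hpM : p ≤ M := le_max_left _ _
  have hqM : q ≤ M := le_max_right _ _
  have hMd : M - p ≤ d := by
    rcases max_choice p q with h | h <;> rw [hM, h] <;> linarith
  have hMn : M ^ n ≤ 2 * p ^ n := by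
    refine pow_le_two_mul_pow (by linarith) hpM ?_
    have h1 := hbern n
    have h2 : (n : ℝ) * (M - p) ≤ n * d := mul_le_mul_of_nonneg_left hMd n.cast_nonneg
    nlinarith
  have hMk0 : 0 < M ^ k := pow_pos (by linarith) k
  have hMk : 10 ≤ M ^ k := by
    calc (10 : ℝ) ≤ (19 / 10) ^ 4 := by norm_num
      _ ≤ M ^ 4 := by gcongr; linarith
      _ ≤ M ^ k := pow_le_pow_right₀ (by linarith) hk
  have hr : (∑ j ∈ range m, (q ^ k) ^ j) * M ^ k ≤ 10 / 9 * M ^ n := by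
    have h1 : ∑ j ∈ range m, (q ^ k) ^ j ≤ ∑ j ∈ range m, (M ^ k) ^ j := by gcongr
    have h2 := geom_sum_mul (M ^ k) m
    rw [← pow_mul, mul_comm k m, ← hn] at h2
    have h3 : 0 ≤ ∑ j ∈ range m, (M ^ k) ^ j := sum_nonneg fun i _ => by positivity
    have h4 := mul_le_mul_of_nonneg_right h1 hMk0.le
    nlinarith
  have hr0 : 0 ≤ ∑ j ∈ range m, (q ^ k) ^ j := sum_nonneg fun i _ => by positivity
  have hD : |(2 - q) * q ^ k - 1| ≤ 19 / 9 * (d * M ^ k) := by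
    have h1 : (2 - q) * q ^ k - 1 = (2 - p) * (q ^ k - p ^ k) + (p - q) * q ^ k := by
      linear_combination he
    have h2 : |q ^ k - p ^ k| ≤ d * k * M ^ k := by
      have := abs_pow_sub_pow_le q p k
      rw [abs_of_pos (by linarith : 0 < q), abs_of_pos (by linarith : 0 < p), max_comm q p,
        ← hM, ← hd] at this
      refine this.trans (mul_le_mul_of_nonneg_left ?_ (by positivity))
      exact pow_le_pow_right₀ (by linarith) (Nat.sub_le _ _)
    have h3 : (2 - p) * k ≤ 10 / 9 := by
      have := mul_le_mul_of_nonneg_left (hbern k) he0.le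
      linarith
    have h4 : q ^ k ≤ M ^ k := by gcongr
    calc |(2 - q) * q ^ k - 1| ≤ |(2 - p) * (q ^ k - p ^ k)| + |(p - q) * q ^ k| := by
          rw [h1]; exact abs_add_le _ _
      _ = (2 - p) * |q ^ k - p ^ k| + d * q ^ k := by
          rw [abs_mul, abs_mul, abs_of_pos he0, abs_sub_comm p q, ← hd,
            abs_of_pos (by positivity : 0 < q ^ k)]
      _ ≤ (2 - p) * (d * k * M ^ k) + d * M ^ k := by gcongr
      _ = (2 - p) * k * (d * M ^ k) + d * M ^ k := by ring
      _ ≤ 10 / 9 * (d * M ^ k) + d * M ^ k := by gcongr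
      _ = 19 / 9 * (d * M ^ k) := by ring
  rw [abs_mul, abs_of_nonneg hr0]
  calc _ ≤ (∑ j ∈ range m, (q ^ k) ^ j) * (19 / 9 * (d * M ^ k)) := by gcongr
    _ = 19 / 9 * d * ((∑ j ∈ range m, (q ^ k) ^ j) * M ^ k) := by ring
    _ ≤ 19 / 9 * d * (10 / 9 * (2 * p ^ n)) :=
        mul_le_mul_of_nonneg_left (hr.trans (by gcongr)) (by positivity)
    _ = 380 / 81 * (d * p ^ n) := by ring
    _ ≤ 2 - q := by linarith

theorem expansion_of_one_has_prefix
    (m k : ℕ) (hm : 1 ≤ m) (hk : 4 ≤ k) (qk : ℝ) (hqk : IsBonacci k qk)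
    (q : ℝ) (hq : q ∈ Set.Ioo (1 : ℝ) 2)
    (hclose : |q - qk| < qk ^ (-(((m : ℤ) + 1) * (k : ℤ)) - 3)) :
    ∃ c : ℕ → ℝ, IsDigitSeq c ∧ piQ q c = 1 ∧
      ∀ j < m * k, c j = if j % k = k - 1 then 0 else 1 := by
  have hqk0 : 0 < qk := by linarith [hqk.1.1]
  have hclose' : |q - qk| * (qk ^ (m * k) * qk ^ k * qk ^ 3) < 1 := by
    have hexp : -(((m : ℤ) + 1) * (k : ℤ)) - 3 = -((m * k + k + 3 : ℕ) : ℤ) := by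
      push_cast
      ring
    rw [hexp, zpow_neg, zpow_natCast, ← one_div, lt_div_iff₀ (by positivity)] at hclose
    rwa [← pow_add, ← pow_add]
  obtain ⟨habs, hq32⟩ := abs_geom_sum_mul_le hk hqk hq.1 hclose'
  rw [abs_le] at habs
  have horbit := digitOrbit_seqP_mul q (by omega : 1 ≤ k) m
  have hmul : (q - 1) * digitOrbit q (seqP k) 1 (m * k) =
      (q - 1) - (∑ j ∈ Finset.range m, (q ^ k) ^ j) * ((2 - q) * q ^ k - 1) := by
    rw [horbit]
    linear_combination (-∑ j ∈ Finset.range m, (q ^ k) ^ j) * mul_geom_sum q k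
  have hpos : 0 < q - 1 := by linarith
  refine exists_expansion_of_prefix_orbit hq (isDigitSeq_seqP k)
    (x := digitOrbit q (seqP k) 1) (fun _ => rfl) (m * k) ⟨?_, ?_⟩
  · exact nonneg_of_mul_nonneg_right (by linarith) hpos
  · rw [le_div_iff₀ hpos]
    linarith
end
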